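/- arXiv:2003.12707 — 2 statements merged into one kernel-verified Lean document; each statement's English description precedes it below -/
import Mathlib

section
/- Define α(n) by ∑_{n≥0} α(n) q^n = (q,q^4;q^5)_∞^2 (-q^4,-q^6;q^{10})_∞ / ((q^2,q^3;q^5)_∞^2 (-q^2,-q^8;q^{10})_∞). Then α(10n+3)=0 and α(10n+7)=0 for all n≥0. -/
/-- Euler's product E(q) = ∏_{k≥0} (1 - q^{k+1}). -/
noncomputable def E (q : ℂ) : ℂ := ∏' k : ℕ, (1 - q ^ (k + 1))

/-- q-Pochhammer infinite product (a;q)_∞ = ∏_{k≥0} (1 - a q^k). -/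
noncomputable def qp (a q : ℂ) : ℂ := ∏' k : ℕ, (1 - a * q ^ k)

/-- Rogers–Ramanujan function G(q) = 1/((q,q^4;q^5)_∞). -/
noncomputable def G (q : ℂ) : ℂ := 1 / (qp q (q ^ 5) * qp (q ^ 4) (q ^ 5))

/-- Rogers–Ramanujan function H(q) = 1/((q^2,q^3;q^5)_∞). -/
noncomputable def H (q : ℂ) : ℂ := 1 / (qp (q ^ 2) (q ^ 5) * qp (q ^ 3) (q ^ 5))

/-- Rogers–Ramanujan continued fraction product R(q). -/
noncomputable def R (q : ℂ) : ℂ :=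
  (qp q (q ^ 5) * qp (q ^ 4) (q ^ 5)) / (qp (q ^ 2) (q ^ 5) * qp (q ^ 3) (q ^ 5))

open Filter Topology Finset

section Pochhammer

variable {q : ℂ}

lemma summable_mul_pow_of_norm_lt_one (a : ℂ) (hq : ‖q‖ < 1) :
    Summable fun k : ℕ ↦ ‖-(a * q ^ k)‖ := by
  simpa [norm_mul, norm_pow] using
    (summable_geometric_of_lt_one (norm_nonneg _) hq).mul_left ‖a‖

lemma tendsto_prod_qp (a : ℂ) (hq : ‖q‖ < 1) :
    Tendsto (fun n ↦ ∏ k ∈ range n, (1 - a * q ^ k)) atTop (𝓝 (qp a q)) := by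
  have h : Multipliable fun k : ℕ ↦ 1 + -(a * q ^ k) :=
    multipliable_one_add_of_summable (summable_mul_pow_of_norm_lt_one a hq)
  simpa [qp, sub_eq_add_neg] using h.hasProd.tendsto_prod_nat

lemma qp_ne_zero {a : ℂ} (ha : ‖a‖ < 1) (hq : ‖q‖ < 1) : qp a q ≠ 0 := by
  have h := tprod_one_add_ne_zero_of_summable (f := fun k : ℕ ↦ -(a * q ^ k)) (fun k ↦ ?_)
    (summable_mul_pow_of_norm_lt_one a hq)
  · simpa [qp, sub_eq_add_neg] using h
  · intro h
    have h1 : a * q ^ k = 1 := by linear_combination -h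
    have h2 : ‖a * q ^ k‖ < 1 := by
      rw [norm_mul, norm_pow]
      exact mul_lt_one_of_nonneg_of_lt_one_left (norm_nonneg _) ha
        (pow_le_one₀ (norm_nonneg _) hq.le)
    simp [h1] at h2

lemma qp_eq_prod_qp_pow (a : ℂ) (hq : ‖q‖ < 1) {m : ℕ} (hm : 0 < m) :
    qp a q = ∏ i ∈ range m, qp (a * q ^ i) (q ^ m) := by
  have hqm : ‖q ^ m‖ < 1 := by
    rw [norm_pow]; exact pow_lt_one₀ (norm_nonneg _) hq hm.ne'
  have h1 : Tendsto (fun n ↦ ∏ i ∈ range m, ∏ k ∈ range n, (1 - a * q ^ i * (q ^ m) ^ k)) atTop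
      (𝓝 (∏ i ∈ range m, qp (a * q ^ i) (q ^ m))) :=
    tendsto_finsetProd _ fun i _ ↦ tendsto_prod_qp _ hqm
  have h2 := (tendsto_prod_qp a hq).comp (tendsto_id.const_mul_atTop' hm)
  refine tendsto_nhds_unique h2 (h1.congr fun n ↦ ?_)
  simp only [Function.comp_apply, id]
  induction n with
  | zero => simp
  | succ n ih =>
    simp only [prod_range_succ, prod_mul_distrib, mul_add, mul_one, prod_range_add, ih]
    congr 1
    exact prod_congr rfl fun i _ ↦ by ring

lemma qp_mul_qp_neg (a : ℂ) (hq : ‖q‖ < 1) : qp a q * qp (-a) q = qp (a ^ 2) (q ^ 2) := by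
  have hq2 : ‖q ^ 2‖ < 1 := by
    rw [norm_pow]; exact pow_lt_one₀ (norm_nonneg _) hq two_ne_zero
  refine tendsto_nhds_unique ((tendsto_prod_qp a hq).mul (tendsto_prod_qp (-a) hq))
    ((tendsto_prod_qp _ hq2).congr fun n ↦ ?_)
  rw [← prod_mul_distrib]
  exact prod_congr rfl fun i _ ↦ by ring

end Pochhammer

section TripleProduct

/-- The theta series `∑ zⁿ r^(n²)` over the integers. -/
noncomputable def thetaSeries (z r : ℂ) : ℂ := ∑' n : ℤ, z ^ n * r ^ n ^ 2

lemma summable_thetaSeries {z r : ℂ} (hz : z ≠ 0) (hr0 : r ≠ 0) (hr : ‖r‖ < 1) :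
    Summable fun n : ℤ ↦ ‖z ^ n * r ^ n ^ 2‖ := by
  have key : ∀ w : ℂ, w ≠ 0 → Summable fun n : ℕ ↦ ‖w ^ n * r ^ n ^ 2‖ := by
    intro w hw
    refine summable_of_ratio_test_tendsto_lt_one (l := 0) zero_lt_one
      (Eventually.of_forall fun n ↦ by simp [hw, hr0]) ?_
    have h : Tendsto (fun n : ℕ ↦ ‖w‖ * ‖r‖ * (‖r‖ ^ 2) ^ n) atTop (𝓝 (‖w‖ * ‖r‖ * 0)) :=
      (tendsto_pow_atTop_nhds_zero_of_lt_one (by positivity)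
        (pow_lt_one₀ (norm_nonneg _) hr two_ne_zero)).const_mul _
    rw [mul_zero] at h
    refine h.congr fun n ↦ ?_
    simp only [norm_mul, norm_pow, norm_norm]
    field_simp
    ring
  refine Summable.of_nat_of_neg ?_ ?_
  · simpa [← zpow_natCast] using key z hz
  · simpa [← zpow_natCast] using key z⁻¹ (inv_ne_zero hz)

/-- The finite product `(p; p)_n`. -/
noncomputable def finPoch (p : ℂ) (n : ℕ) : ℂ := ∏ i ∈ range n, (1 - p * p ^ i)

lemma finPoch_ne_zero {p : ℂ} (hp : ‖p‖ < 1) (n : ℕ) : finPoch p n ≠ 0 := by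
  refine prod_ne_zero_iff.mpr fun i _ h ↦ ?_
  have h1 : p ^ (i + 1) = 1 := by linear_combination -h
  have h2 : ‖p ^ (i + 1)‖ < 1 := by
    rw [norm_pow]; exact pow_lt_one₀ (norm_nonneg _) hp (by simp)
  simp [h1] at h2

/-- The Gaussian binomial coefficient as a quotient of finite products, for `‖p‖ < 1`. -/
noncomputable def gaussBinom (p : ℂ) (N k : ℕ) : ℂ :=
  if k ≤ N then finPoch p N / (finPoch p k * finPoch p (N - k)) else 0

lemma gaussBinom_zero {p : ℂ} (hp : ‖p‖ < 1) (N : ℕ) : gaussBinom p N 0 = 1 := by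
  simp [gaussBinom, div_self (finPoch_ne_zero hp N), show finPoch p 0 = 1 by simp [finPoch]]

lemma gaussBinom_succ_succ {p : ℂ} (hp : ‖p‖ < 1) {N k : ℕ} (hk : k ≤ N) :
    gaussBinom p (N + 1) (k + 1) = gaussBinom p N (k + 1) + p ^ (N - k) * gaussBinom p N k := by
  have hne := finPoch_ne_zero hp
  have hs (n : ℕ) : finPoch p (n + 1) = finPoch p n * (1 - p ^ (n + 1)) := by
    rw [finPoch, prod_range_succ, ← finPoch]; ring
  have hs' (n : ℕ) : 1 - p ^ (n + 1) ≠ 0 := fun h ↦ hne (n + 1) (by rw [hs, h, mul_zero])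
  obtain ⟨m, rfl⟩ := Nat.exists_eq_add_of_le hk
  have hk1 := hs' k
  rcases m with _ | m
  · have hf : finPoch p 0 = 1 := by simp [finPoch]
    simp [gaussBinom, hf, hne]
  · have hm0 := hne m
    have hm1 := hs' m
    simp only [gaussBinom, if_pos (show k + 1 ≤ k + (m + 1) + 1 by omega),
      if_pos (show k + 1 ≤ k + (m + 1) by omega), if_pos (show k ≤ k + (m + 1) by omega),
      show k + (m + 1) + 1 - (k + 1) = m + 1 by omega, show k + (m + 1) - (k + 1) = m by omega,
      show k + (m + 1) - k = m + 1 by omega]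
    rw [hs (k + (m + 1)), hs k, hs m]
    field_simp
    ring

/-- The finite `q`-binomial theorem. -/
lemma prod_one_add_eq_sum {r : ℂ} (hr : ‖r‖ < 1) (y : ℂ) (N : ℕ) :
    ∏ k ∈ range N, (1 + y * r ^ (2 * k + 1)) =
      ∑ k ∈ range (N + 1), gaussBinom (r ^ 2) N k * (y ^ k * r ^ k ^ 2) := by
  have hp : ‖r ^ 2‖ < 1 := by
    rw [norm_pow]; exact pow_lt_one₀ (norm_nonneg _) hr two_ne_zero
  induction N with
  | zero => simp [gaussBinom_zero hp]
  | succ N ih =>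
    have h : ∑ k ∈ range (N + 1), gaussBinom (r ^ 2) (N + 1) (k + 1) *
          (y ^ (k + 1) * r ^ (k + 1) ^ 2) =
        ∑ k ∈ range (N + 1), gaussBinom (r ^ 2) N (k + 1) * (y ^ (k + 1) * r ^ (k + 1) ^ 2) +
        y * r ^ (2 * N + 1) * ∑ k ∈ range (N + 1), gaussBinom (r ^ 2) N k *
          (y ^ k * r ^ k ^ 2) := by
      rw [mul_sum, ← sum_add_distrib]
      refine sum_congr rfl fun k hk ↦ ?_
      obtain ⟨m, rfl⟩ := Nat.exists_eq_add_of_le (Nat.lt_succ_iff.mp (mem_range.mp hk))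
      rw [gaussBinom_succ_succ hp (by omega), Nat.add_sub_cancel_left]
      ring
    have h' := sum_range_succ (fun k ↦ gaussBinom (r ^ 2) N k * (y ^ k * r ^ k ^ 2)) (N + 1)
    rw [sum_range_succ'] at h'
    have hz : gaussBinom (r ^ 2) N (N + 1) = 0 := by simp [gaussBinom]
    rw [prod_range_succ, ih, sum_range_succ' _ (N + 1), h, gaussBinom_zero hp]
    rw [gaussBinom_zero hp, hz] at h'
    linear_combination -h'

/-- The symmetric finite form of the Jacobi triple product. -/
lemma prod_mul_prod_eq_sum {z r : ℂ} (hz : z ≠ 0) (hr0 : r ≠ 0) (hr : ‖r‖ < 1) (N : ℕ) :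
    (∏ k ∈ range N, (1 - -z * r * (r ^ 2) ^ k)) * ∏ k ∈ range N, (1 - -r / z * (r ^ 2) ^ k) =
      ∑ k ∈ range (2 * N + 1), gaussBinom (r ^ 2) (2 * N) k *
        (z ^ ((k : ℤ) - N) * r ^ ((k : ℤ) - N) ^ 2) := by
  have hsq : r ^ N ^ 2 = ∏ k ∈ range N, r ^ (2 * k + 1) := by
    rw [prod_pow_eq_pow_sum]
    congr 1
    induction N with
    | zero => simp
    | succ n ih => rw [sum_range_succ, ← ih]; ring
  have hlow : ∏ k ∈ range N, (1 + z / r ^ (2 * N) * r ^ (2 * k + 1)) =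
      z ^ N / r ^ N ^ 2 * ∏ k ∈ range N, (1 - -r / z * (r ^ 2) ^ k) := by
    have hzr : z ^ N / r ^ N ^ 2 = ∏ k ∈ range N, (z / r ^ (2 * k + 1)) := by
      rw [prod_div_distrib, prod_const, card_range, hsq]
    rw [hzr, ← prod_mul_distrib, ← prod_range_reflect]
    refine prod_congr rfl fun k hk ↦ ?_
    obtain ⟨m, rfl⟩ := Nat.exists_eq_add_of_lt (mem_range.mp hk)
    rw [show k + m + 1 - 1 - k = m by omega]
    field_simp
    ring
  have hhigh : ∏ k ∈ range N, (1 + z / r ^ (2 * N) * r ^ (2 * (N + k) + 1)) =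
      ∏ k ∈ range N, (1 - -z * r * (r ^ 2) ^ k) := by
    refine prod_congr rfl fun k _ ↦ ?_
    field_simp
    ring
  have h := prod_one_add_eq_sum hr (z / r ^ (2 * N)) (2 * N)
  rw [two_mul, prod_range_add, ← two_mul, hlow, hhigh] at h
  have hc : z ^ N / r ^ N ^ 2 ≠ 0 := by positivity
  refine mul_left_cancel₀ hc ?_
  rw [mul_comm (∏ k ∈ range N, _), ← mul_assoc, h, mul_sum]
  refine sum_congr rfl fun k _ ↦ ?_
  have e1 : z ^ k = z ^ N * z ^ ((k : ℤ) - N) := by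
    rw [← zpow_natCast, ← zpow_natCast, ← zpow_add₀ hz]; congr 1; ring
  have e2 : r ^ k ^ 2 * r ^ N ^ 2 = r ^ ((k : ℤ) - N) ^ 2 * (r ^ (2 * N)) ^ k := by
    simp only [← zpow_natCast, ← zpow_add₀ hr0, ← zpow_mul]; congr 1; push_cast; ring
  rw [div_pow, e1]
  field_simp
  linear_combination (gaussBinom (r ^ 2) (2 * N) k) * e2

lemma tendsto_finPoch {p : ℂ} (hp : ‖p‖ < 1) : Tendsto (finPoch p) atTop (𝓝 (qp p p)) :=
  tendsto_prod_qp p hp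

lemma exists_norm_gaussBinom_le {p : ℂ} (hp : ‖p‖ < 1) :
    ∃ M : ℝ, ∀ N k, ‖gaussBinom p N k‖ ≤ M := by
  have h := tendsto_finPoch hp
  obtain ⟨A, hA⟩ := (Metric.isBounded_range_of_tendsto _ h).exists_norm_le
  obtain ⟨B, hB⟩ :=
    (Metric.isBounded_range_of_tendsto _ (h.inv₀ (qp_ne_zero hp hp))).exists_norm_le
  simp only [Set.mem_range, forall_exists_index, forall_apply_eq_imp_iff] at hA hB
  have hA0 : 0 ≤ A := (norm_nonneg _).trans (hA 0)
  have hB0 : 0 ≤ B := (norm_nonneg _).trans (hB 0)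
  refine ⟨A * (B * B), fun N k ↦ ?_⟩
  rw [gaussBinom]
  split_ifs
  · rw [div_eq_mul_inv, mul_inv, norm_mul, norm_mul]
    gcongr
    exacts [hA N, hB k, hB (N - k)]
  · rw [norm_zero]; positivity

lemma tendsto_gaussBinom {p : ℂ} (hp : ‖p‖ < 1) (j : ℤ) :
    Tendsto (fun N : ℕ ↦ gaussBinom p (2 * N) (N + j).toNat) atTop (𝓝 (qp p p)⁻¹) := by
  have h := tendsto_finPoch hp
  have h2 : Tendsto (fun N : ℕ ↦ 2 * N) atTop atTop :=
    tendsto_id.const_mul_atTop' two_pos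
  have hj (i : ℤ) : Tendsto (fun N : ℕ ↦ ((N : ℤ) + i).toNat) atTop atTop :=
    tendsto_atTop_mono (fun N ↦ show N - i.natAbs ≤ ((N : ℤ) + i).toNat by omega)
      (tendsto_sub_atTop_nat i.natAbs)
  have h3 := (h.comp h2).div ((h.comp (hj j)).mul (h.comp (hj (-j))))
    (mul_ne_zero (qp_ne_zero hp hp) (qp_ne_zero hp hp))
  rw [show qp p p / (qp p p * qp p p) = (qp p p)⁻¹ by
    have := qp_ne_zero hp hp
    field_simp] at h3
  refine h3.congr' ?_
  filter_upwards [eventually_ge_atTop j.natAbs] with N hN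
  rw [gaussBinom, if_pos (by omega), show 2 * N - ((N : ℤ) + j).toNat = ((N : ℤ) + -j).toNat by omega]
  rfl

/-- The **Jacobi triple product** identity. -/
theorem thetaSeries_eq_qp {z r : ℂ} (hz : z ≠ 0) (hr0 : r ≠ 0) (hr : ‖r‖ < 1) :
    thetaSeries z r = qp (-z * r) (r ^ 2) * qp (-r / z) (r ^ 2) * qp (r ^ 2) (r ^ 2) := by
  have hp : ‖r ^ 2‖ < 1 := by
    rw [norm_pow]; exact pow_lt_one₀ (norm_nonneg _) hr two_ne_zero
  set p := r ^ 2 with hpdef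
  obtain ⟨M, hM⟩ := exists_norm_gaussBinom_le hp
  have hM0 : 0 ≤ M := (norm_nonneg _).trans (hM 0 0)
  let F (N : ℕ) (j : ℤ) : ℂ :=
    if -(N : ℤ) ≤ j then gaussBinom p (2 * N) (N + j).toNat * (z ^ j * r ^ j ^ 2) else 0
  have hF (N : ℕ) : ∑' j, F N j = (∏ k ∈ range N, (1 - -z * r * p ^ k)) *
      ∏ k ∈ range N, (1 - -r / z * p ^ k) := by
    rw [prod_mul_prod_eq_sum hz hr0 hr]
    rw [tsum_eq_sum (s := (range (2 * N + 1)).image fun k : ℕ ↦ (k : ℤ) - N),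
      sum_image fun a _ b _ h ↦ by simpa using h]
    · refine sum_congr rfl fun k _ ↦ ?_
      simp only [F]
      rw [if_pos (by omega), show ((N : ℤ) + (k - N)).toNat = k by omega]
    · intro j hj
      simp only [F]
      split_ifs with h
      · rw [gaussBinom, if_neg, zero_mul]
        intro h'
        refine hj (mem_image.mpr ⟨((N : ℤ) + j).toNat, mem_range.mpr (by omega), by omega⟩)
      · rfl
  have hlim : Tendsto (fun N ↦ ∑' j, F N j) atTop
      (𝓝 (∑' j : ℤ, (qp p p)⁻¹ * (z ^ j * r ^ j ^ 2))) := by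
    refine tendsto_tsum_of_dominated_convergence
      ((summable_thetaSeries hz hr0 hr).mul_left M) (fun j ↦ ?_)
      (Eventually.of_forall fun N j ↦ ?_)
    · refine ((tendsto_gaussBinom hp j).mul_const _).congr' ?_
      filter_upwards [eventually_ge_atTop j.natAbs] with N hN
      simp only [F]
      rw [if_pos (by omega)]
    · simp only [F]
      split_ifs
      · rw [norm_mul]
        gcongr
        exact hM _ _
      · rw [norm_zero]; positivity
  have hlim' := (tendsto_prod_qp (-z * r) hp).mul (tendsto_prod_qp (-r / z) hp)
  have := tendsto_nhds_unique hlim (hlim'.congr fun N ↦ (hF N).symm)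
  rw [tsum_mul_left] at this
  have hne := qp_ne_zero hp hp
  rw [thetaSeries, ← this]
  field_simp

end TripleProduct

section ThetaProducts

lemma hasSum_int_prod_of_even_of_odd {f : ℤ × ℤ → ℂ} {a b : ℂ}
    (ha : HasSum (fun x : ℤ × ℤ ↦ f (x.1 + x.2, x.1 - x.2)) a)
    (hb : HasSum (fun x : ℤ × ℤ ↦ f (x.1 + x.2 + 1, x.1 - x.2)) b) : HasSum f (a + b) := by
  have he : Function.Injective fun x : ℤ × ℤ ↦ (x.1 + x.2, x.1 - x.2) := by
    rintro ⟨s, t⟩ ⟨u, v⟩ h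
    simp only [Prod.mk.injEq] at h ⊢
    omega
  have ho : Function.Injective fun x : ℤ × ℤ ↦ (x.1 + x.2 + 1, x.1 - x.2) := by
    rintro ⟨s, t⟩ ⟨u, v⟩ h
    simp only [Prod.mk.injEq] at h ⊢
    omega
  refine HasSum.add_isCompl (s := Set.range fun x : ℤ × ℤ ↦ (x.1 + x.2, x.1 - x.2))
    (t := Set.range fun x : ℤ × ℤ ↦ (x.1 + x.2 + 1, x.1 - x.2)) ⟨?_, ?_⟩
    (he.hasSum_range_iff.mpr ha) (ho.hasSum_range_iff.mpr hb)
  · rw [Set.disjoint_left]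
    rintro _ ⟨⟨s, t⟩, rfl⟩ ⟨⟨u, v⟩, h⟩
    simp only [Prod.mk.injEq] at h
    omega
  · rw [codisjoint_iff_le_sup]
    rintro ⟨m, n⟩ -
    rcases Int.emod_two_eq_zero_or_one (m + n) with h | h
    · refine Or.inl ⟨((m + n) / 2, (m - n) / 2), ?_⟩
      simp only [Prod.mk.injEq]
      omega
    · refine Or.inr ⟨((m + n) / 2, (m - n) / 2), ?_⟩
      simp only [Prod.mk.injEq]
      omega

lemma hasSum_thetaSeries {z r : ℂ} (hz : z ≠ 0) (hr0 : r ≠ 0) (hr : ‖r‖ < 1) :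
    HasSum (fun n : ℤ ↦ z ^ n * r ^ n ^ 2) (thetaSeries z r) :=
  (summable_thetaSeries hz hr0 hr).of_norm.hasSum

lemma hasSum_int_prod_mul {f g : ℤ → ℂ} {a b : ℂ} (hf : HasSum f a) (hg : HasSum g b)
    (hf' : Summable fun n ↦ ‖f n‖) (hg' : Summable fun n ↦ ‖g n‖) :
    HasSum (fun x : ℤ × ℤ ↦ f x.1 * g x.2) (a * b) :=
  HasSum.mul hf hg (summable_mul_of_summable_norm hf' hg')

lemma hasSum_thetaSeries_mul {z w r : ℂ} (hz : z ≠ 0) (hw : w ≠ 0) (hr0 : r ≠ 0) (hr : ‖r‖ < 1) :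
    HasSum (fun x : ℤ × ℤ ↦ z ^ x.1 * r ^ x.1 ^ 2 * (w ^ x.2 * r ^ x.2 ^ 2))
      (thetaSeries z r * thetaSeries w r) :=
  hasSum_int_prod_mul (f := fun n : ℤ ↦ z ^ n * r ^ n ^ 2) (g := fun n : ℤ ↦ w ^ n * r ^ n ^ 2)
    (hasSum_thetaSeries hz hr0 hr) (hasSum_thetaSeries hw hr0 hr)
    (summable_thetaSeries hz hr0 hr) (summable_thetaSeries hw hr0 hr)

lemma thetaSeries_mul_thetaSeries {z w r : ℂ} (hz : z ≠ 0) (hw : w ≠ 0) (hr0 : r ≠ 0)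
    (hr : ‖r‖ < 1) :
    thetaSeries z r * thetaSeries w r =
      thetaSeries (z * w) (r ^ 2) * thetaSeries (z / w) (r ^ 2) +
      z * r * (thetaSeries (z * w * r ^ 2) (r ^ 2) * thetaSeries (z / w * r ^ 2) (r ^ 2)) := by
  have hr2 : ‖r ^ 2‖ < 1 := by
    rw [norm_pow]; exact pow_lt_one₀ (norm_nonneg _) hr two_ne_zero
  have hr20 : r ^ 2 ≠ 0 := pow_ne_zero _ hr0
  have hpow (n : ℤ) : (r ^ 2) ^ n = r ^ (2 * n) := by rw [zpow_mul]; norm_cast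
  have ha := hasSum_thetaSeries_mul (mul_ne_zero hz hw) (div_ne_zero hz hw) hr20 hr2
  have hb := (hasSum_thetaSeries_mul (mul_ne_zero (mul_ne_zero hz hw) hr20)
    (mul_ne_zero (div_ne_zero hz hw) hr20) hr20 hr2).mul_left (z * r)
  refine HasSum.unique (hasSum_thetaSeries_mul hz hw hr0 hr) (hasSum_int_prod_of_even_of_odd ?_ ?_)
  · refine ha.congr_fun fun x ↦ ?_
    obtain ⟨s, t⟩ := x
    dsimp only
    have e : r ^ (s + t) ^ 2 * r ^ (s - t) ^ 2 = r ^ (2 * s ^ 2) * r ^ (2 * t ^ 2) := by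
      simp only [← zpow_add₀ hr0]
      congr 1
      ring
    rw [zpow_add₀ hz, zpow_sub₀ hw, mul_zpow, div_zpow, hpow, hpow]
    field_simp
    linear_combination e
  · refine hb.congr_fun fun x ↦ ?_
    obtain ⟨s, t⟩ := x
    dsimp only
    have e : r ^ (s + t + 1) ^ 2 * r ^ (s - t) ^ 2 =
        r * (r ^ (2 * s) * r ^ (2 * s ^ 2) * (r ^ (2 * t) * r ^ (2 * t ^ 2))) := by
      simp only [← zpow_add₀ hr0, ← zpow_one_add₀ hr0]
      congr 1
      ring
    rw [zpow_add_one₀ hz, zpow_add₀ hz, zpow_sub₀ hw, mul_zpow, mul_zpow, mul_zpow, div_zpow,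
      hpow, hpow, hpow, hpow]
    field_simp
    linear_combination e

end ThetaProducts

section Dissection

/-- The product `R(q)² R(q²) / R(q⁴)`. -/
noncomputable def rrQuotient (q : ℂ) : ℂ :=
  (qp q (q ^ 5) * qp (q ^ 4) (q ^ 5)) ^ 2 * (qp (-(q ^ 4)) (q ^ 10) * qp (-(q ^ 6)) (q ^ 10)) /
    ((qp (q ^ 2) (q ^ 5) * qp (q ^ 3) (q ^ 5)) ^ 2 *
      (qp (-(q ^ 2)) (q ^ 10) * qp (-(q ^ 8)) (q ^ 10)))

lemma qp_eq_qp_sq_mul_qp_sq (a : ℂ) {q : ℂ} (hq : ‖q‖ < 1) :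
    qp a q = qp a (q ^ 2) * qp (a * q) (q ^ 2) := by
  rw [qp_eq_prod_qp_pow a hq (m := 2) (by norm_num)]
  simp [prod_range_succ]

variable {q : ℂ}

lemma norm_pow_lt_one_of_norm_lt_one (hq : ‖q‖ < 1) {n : ℕ} (hn : n ≠ 0) : ‖q ^ n‖ < 1 := by
  rw [norm_pow]
  exact pow_lt_one₀ (norm_nonneg _) hq hn

lemma qp_products_eq (hq0 : q ≠ 0) (hq : ‖q‖ < 1) {ε : ℂ} (hε : ε ^ 2 = 1) :
    qp (ε * q) (q ^ 10) * qp (ε * q ^ 9) (q ^ 10) * (qp (-ε * q ^ 3) (q ^ 10) *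
      qp (-ε * q ^ 7) (q ^ 10)) * qp (q ^ 10) (q ^ 10) ^ 2 =
      qp (q ^ 4) (q ^ 20) * qp (q ^ 16) (q ^ 20) * (qp (q ^ 8) (q ^ 20) * qp (q ^ 12) (q ^ 20)) *
        qp (q ^ 20) (q ^ 20) ^ 2 -
      ε * q * (qp (q ^ 2) (q ^ 20) * qp (q ^ 18) (q ^ 20) * (qp (q ^ 6) (q ^ 20) *
        qp (q ^ 14) (q ^ 20)) * qp (q ^ 20) (q ^ 20) ^ 2) := by
  have hε0 : ε ≠ 0 := by rintro rfl; simp at hε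
  have h5 := norm_pow_lt_one_of_norm_lt_one hq (n := 5) (by norm_num)
  have h10 := norm_pow_lt_one_of_norm_lt_one h5 two_ne_zero
  have h50 : q ^ 5 ≠ 0 := pow_ne_zero _ hq0
  have hz : -ε / q ^ 4 ≠ 0 := by simp [hε0, hq0]
  have hw : ε / q ^ 2 ≠ 0 := by simp [hε0, hq0]
  have h := thetaSeries_mul_thetaSeries hz hw h50 h5
  have hzw := mul_ne_zero hz hw
  have hdw := div_ne_zero hz hw
  have hr2 := pow_ne_zero 2 h50
  rw [thetaSeries_eq_qp hz h50 h5, thetaSeries_eq_qp hw h50 h5, thetaSeries_eq_qp hzw hr2 h10,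
    thetaSeries_eq_qp hdw hr2 h10, thetaSeries_eq_qp (mul_ne_zero hzw hr2) hr2 h10,
    thetaSeries_eq_qp (mul_ne_zero hdw hr2) hr2 h10] at h
  have hinv : ε⁻¹ = ε := by field_simp; exact hε.symm
  rw [show -(-ε / q ^ 4) * q ^ 5 = ε * q by field_simp,
    show -q ^ 5 / (-ε / q ^ 4) = ε⁻¹ * q ^ 9 by field_simp,
    show -(ε / q ^ 2) * q ^ 5 = -ε * q ^ 3 by field_simp,
    show -q ^ 5 / (ε / q ^ 2) = -ε⁻¹ * q ^ 7 by field_simp,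
    show -(-ε / q ^ 4 * (ε / q ^ 2)) * (q ^ 5) ^ 2 = ε ^ 2 * q ^ 4 by field_simp,
    show -(q ^ 5) ^ 2 / (-ε / q ^ 4 * (ε / q ^ 2)) = (ε ^ 2)⁻¹ * q ^ 16 by field_simp,
    show -(-ε / q ^ 4 / (ε / q ^ 2)) * (q ^ 5) ^ 2 = q ^ 8 by field_simp,
    show -(q ^ 5) ^ 2 / (-ε / q ^ 4 / (ε / q ^ 2)) = q ^ 12 by field_simp,
    show -(-ε / q ^ 4 * (ε / q ^ 2) * (q ^ 5) ^ 2) * (q ^ 5) ^ 2 = ε ^ 2 * q ^ 14 by field_simp,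
    show -(q ^ 5) ^ 2 / (-ε / q ^ 4 * (ε / q ^ 2) * (q ^ 5) ^ 2) = (ε ^ 2)⁻¹ * q ^ 6 by field_simp,
    show -(-ε / q ^ 4 / (ε / q ^ 2) * (q ^ 5) ^ 2) * (q ^ 5) ^ 2 = q ^ 18 by field_simp,
    show -(q ^ 5) ^ 2 / (-ε / q ^ 4 / (ε / q ^ 2) * (q ^ 5) ^ 2) = q ^ 2 by field_simp,
    show -ε / q ^ 4 * q ^ 5 = -ε * q by field_simp, hε, hinv] at h
  simp only [← pow_mul, inv_one, one_mul] at h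
  norm_num at h ⊢
  linear_combination h

lemma rrQuotient_mul_eq (hq : ‖q‖ < 1) {ε : ℂ} (hε : ε ^ 2 = 1) :
    rrQuotient (ε * q) = (qp (ε * q) (q ^ 10) * qp (ε * q ^ 9) (q ^ 10) *
      (qp (-ε * q ^ 3) (q ^ 10) * qp (-ε * q ^ 7) (q ^ 10))) ^ 2 /
        (qp (q ^ 2) (q ^ 20) * qp (q ^ 18) (q ^ 20) * (qp (q ^ 6) (q ^ 20) *
        qp (q ^ 14) (q ^ 20))) := by
  have h5 := norm_pow_lt_one_of_norm_lt_one hq (n := 5) (by norm_num)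
  have h10 := norm_pow_lt_one_of_norm_lt_one hq (n := 10) (by norm_num)
  have h20 := norm_pow_lt_one_of_norm_lt_one hq (n := 20) (by norm_num)
  have hε1 : ‖ε‖ = 1 := by
    have h := congrArg norm hε
    rw [norm_pow, norm_one] at h
    exact (pow_eq_one_iff_of_nonneg (norm_nonneg _) two_ne_zero).mp h
  have split5 (a : ℂ) : qp a (ε * q ^ 5) = qp a (q ^ 10) * qp (a * (ε * q ^ 5)) (q ^ 10) := by
    rw [qp_eq_qp_sq_mul_qp_sq _ (by rwa [norm_mul, hε1, one_mul]), mul_pow, hε, one_mul, ← pow_mul]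
  have split10 (i : ℕ) : qp (q ^ i) (q ^ 10) = qp (q ^ i) (q ^ 20) * qp (q ^ (i + 10)) (q ^ 20) := by
    rw [qp_eq_qp_sq_mul_qp_sq _ h10, ← pow_mul, ← pow_add]
  have pair (i : ℕ) : qp (q ^ i) (q ^ 10) * qp (-q ^ i) (q ^ 10) = qp (q ^ (i * 2)) (q ^ 20) := by
    rw [qp_mul_qp_neg _ h10, ← pow_mul, ← pow_mul]
  have pair' (i : ℕ) :
      qp (ε * q ^ i) (q ^ 10) * qp (-ε * q ^ i) (q ^ 10) = qp (q ^ (i * 2)) (q ^ 20) := by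
    rw [neg_mul, qp_mul_qp_neg _ h10, ← pow_mul, mul_pow, hε, one_mul, ← pow_mul]
  have g0 (i : ℕ) (hi : i ≠ 0) : qp (q ^ i) (q ^ 20) ≠ 0 :=
    qp_ne_zero (norm_pow_lt_one_of_norm_lt_one hq hi) h20
  have hε3 : ε ^ 3 = ε := by rw [pow_succ, hε, one_mul]
  have hε4 : ε ^ 4 = 1 := by rw [show 4 = 2 * 2 by norm_num, pow_mul, hε, one_pow]
  have hε5 : ε ^ 5 = ε := by rw [pow_succ, hε4, one_mul]
  have hε6 : ε ^ 6 = 1 := by rw [show 6 = 2 * 3 by norm_num, pow_mul, hε, one_pow]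
  have hε8 : ε ^ 8 = 1 := by rw [show 8 = 2 * 4 by norm_num, pow_mul, hε, one_pow]
  have hε10 : ε ^ 10 = 1 := by rw [show 10 = 2 * 5 by norm_num, pow_mul, hε, one_pow]
  rw [rrQuotient]
  simp only [mul_pow ε q, hε, hε3, hε4, hε5, hε6, hε8, hε10, one_mul]
  simp only [split5]
  rw [show ε * q * (ε * q ^ 5) = q ^ 6 by linear_combination q ^ 6 * hε,
    show q ^ 4 * (ε * q ^ 5) = ε * q ^ 9 by ring, show q ^ 2 * (ε * q ^ 5) = ε * q ^ 7 by ring,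
    show ε * q ^ 3 * (ε * q ^ 5) = q ^ 8 by linear_combination q ^ 8 * hε]
  have p2 := pair 2
  have p4 := pair 4
  have p6 := pair 6
  have p8 := pair 8
  have p3 := pair' 3
  have p7 := pair' 7
  rw [split10] at p2 p4 p6 p8
  simp only [split10 2, split10 4, split10 6, split10 8]
  norm_num at p2 p4 p6 p8 p3 p7 ⊢
  have g2 := g0 2 (by norm_num)
  have g4 := g0 4 (by norm_num)
  have g6 := g0 6 (by norm_num)
  have g8 := g0 8 (by norm_num)
  have g12 := g0 12 (by norm_num)
  have g14 := g0 14 (by norm_num)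
  have g16 := g0 16 (by norm_num)
  have g18 := g0 18 (by norm_num)
  have a3 := left_ne_zero_of_mul (p3.trans_ne g6)
  have a7 := left_ne_zero_of_mul (p7.trans_ne g14)
  replace p2 := eq_div_of_mul_eq (mul_ne_zero g2 g12) ((mul_comm _ _).trans p2)
  replace p4 := eq_div_of_mul_eq (mul_ne_zero g4 g14) ((mul_comm _ _).trans p4)
  replace p6 := eq_div_of_mul_eq (mul_ne_zero g6 g16) ((mul_comm _ _).trans p6)
  replace p8 := eq_div_of_mul_eq (mul_ne_zero g8 g18) ((mul_comm _ _).trans p8)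
  replace p3 := eq_div_of_mul_eq a3 ((mul_comm _ _).trans p3)
  replace p7 := eq_div_of_mul_eq a7 ((mul_comm _ _).trans p7)
  rw [p2, p4, p6, p8, p3, p7]
  field_simp

lemma rrQuotient_sub_rrQuotient_neg (hq0 : q ≠ 0) (hq : ‖q‖ < 1) :
    rrQuotient q - rrQuotient (-q) = qp (q ^ 20) (q ^ 20) ^ 3 / qp (q ^ 10) (q ^ 10) ^ 4 *
      (-4 * q * qp (q ^ 4) (q ^ 4)) := by
  have h4 := norm_pow_lt_one_of_norm_lt_one hq (n := 4) (by norm_num)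
  have h10 := norm_pow_lt_one_of_norm_lt_one hq (n := 10) (by norm_num)
  have h20 := norm_pow_lt_one_of_norm_lt_one hq (n := 20) (by norm_num)
  have split4 : qp (q ^ 4) (q ^ 4) = qp (q ^ 4) (q ^ 20) * qp (q ^ 8) (q ^ 20) *
      qp (q ^ 12) (q ^ 20) * qp (q ^ 16) (q ^ 20) * qp (q ^ 20) (q ^ 20) := by
    rw [qp_eq_prod_qp_pow _ h4 (m := 5) (by norm_num)]
    simp only [prod_range_succ, prod_range_zero, ← pow_mul, ← pow_add]
    norm_num
  have g0 (i : ℕ) (hi : i ≠ 0) : qp (q ^ i) (q ^ 20) ≠ 0 :=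
    qp_ne_zero (norm_pow_lt_one_of_norm_lt_one hq hi) h20
  have t0 : qp (q ^ 10) (q ^ 10) ≠ 0 := qp_ne_zero h10 h10
  have g2 := g0 2 (by norm_num)
  have g6 := g0 6 (by norm_num)
  have g14 := g0 14 (by norm_num)
  have g18 := g0 18 (by norm_num)
  have hU := qp_products_eq hq0 hq (ε := 1) (by norm_num)
  have hV := qp_products_eq hq0 hq (ε := -1) (by norm_num)
  have hf := rrQuotient_mul_eq hq (ε := 1) (by norm_num)
  have hf' := rrQuotient_mul_eq hq (ε := -1) (by norm_num)
  rw [← eq_div_iff (pow_ne_zero 2 t0)] at hU hV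
  rw [hU, one_mul] at hf
  rw [hV, neg_one_mul q] at hf'
  rw [hf, hf', split4]
  field_simp
  ring

/-- Euler's pentagonal number theorem, in the form of a bilateral theta series. -/
lemma hasSum_qp_self (hq0 : q ≠ 0) (hq : ‖q‖ < 1) :
    HasSum (fun n : ℤ ↦ (-1) ^ n * q ^ (6 * n ^ 2 - 2 * n)) (qp (q ^ 4) (q ^ 4)) := by
  have h4 := norm_pow_lt_one_of_norm_lt_one hq (n := 4) (by norm_num)
  have h6 := norm_pow_lt_one_of_norm_lt_one hq (n := 6) (by norm_num)
  have h60 := pow_ne_zero 6 hq0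
  have hz : -1 / q ^ 2 ≠ 0 := by simp [hq0]
  have h := hasSum_thetaSeries hz h60 h6
  rw [thetaSeries_eq_qp hz h60 h6] at h
  convert h using 1
  · ext n
    rw [div_zpow, ← zpow_natCast q 2, ← zpow_natCast q 6, ← zpow_mul, ← zpow_mul, zpow_sub₀ hq0]
    push_cast
    field_simp
  · rw [qp_eq_prod_qp_pow _ h4 (m := 3) (by norm_num)]
    rw [show -(-1 / q ^ 2) * q ^ 6 = q ^ 4 by field_simp,
      show -q ^ 6 / (-1 / q ^ 2) = q ^ 8 by field_simp]
    simp only [prod_range_succ, prod_range_zero, ← pow_mul, ← pow_add]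
    norm_num

end Dissection

section Coefficients

/-- A power series `∑ aₙ qⁿ` that equals a function of `q⁵` times a series in powers of `q` whose
exponents avoid a residue class modulo `5` has vanishing coefficients in that class. -/
lemma coeff_eq_zero_of_hasSum {a : ℕ → ℂ} {F : ℂ → ℂ} {b : ℤ → ℂ} {e : ℤ → ℤ} {r : ℕ}
    (hr : r ≠ 0) (hr5 : r < 5) (he : ∀ m, ¬ e m ≡ r [ZMOD 5])
    (h : ∀ q : ℂ, q ≠ 0 → ‖q‖ < 1 → ∃ S : ℂ, HasSum (fun m : ℤ ↦ b m * q ^ e m) S ∧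
      HasSum (fun n ↦ a n * q ^ n) (F (q ^ 5) * S))
    {n : ℕ} (hn : n % 5 = r) : a n = 0 := by
  have hω := Complex.isPrimitiveRoot_exp 5 (by norm_num)
  set ω := Complex.exp (2 * Real.pi * Complex.I / (5 : ℕ))
  have hω0 : ω ≠ 0 := hω.ne_zero (by norm_num)
  have hωn (j : ℕ) : ‖ω ^ j‖ = 1 := by
    rw [norm_pow, hω.norm'_eq_one (by norm_num), one_pow]
  have hsum (k : ℤ) : ∑ j ∈ range 5, (ω ^ k) ^ j = if 5 ∣ k then 5 else 0 := by
    split_ifs with hk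
    · simp [(hω.zpow_eq_one_iff_dvd k).mpr hk]
    · have hk1 : ω ^ k ≠ 1 := mt (hω.zpow_eq_one_iff_dvd k).mp hk
      rw [geom_sum_eq hk1, ← zpow_natCast, ← zpow_mul, mul_comm, zpow_mul, zpow_natCast,
        hω.pow_eq_one, one_zpow, sub_self, zero_div]
  let c (n : ℕ) : ℂ := if n % 5 = r then a n else 0
  have hc (q : ℂ) (hq : ‖q‖ < 1) : HasSum (fun n ↦ q ^ n • c n) 0 := by
    rcases eq_or_ne q 0 with rfl | hq0
    · convert hasSum_zero with n
      rcases n with - | n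
      · simp [c, hr.symm]
      · simp
    choose S hS hSF using fun j : ℕ ↦ h (ω ^ j * q) (mul_ne_zero (pow_ne_zero j hω0) hq0)
      (by rwa [norm_mul, hωn, one_mul])
    have hS0 : ∑ j ∈ range 5, (ω ^ (-r : ℤ)) ^ j * S j = 0 := by
      refine (hasSum_sum fun j _ ↦ (hS j).mul_left _).unique ?_
      convert hasSum_zero with m
      have hm : ¬ (5 : ℤ) ∣ e m - r := fun hd ↦ he m (Int.modEq_iff_dvd.mpr hd).symm
      have := hsum (e m - r)
      rw [if_neg hm] at this
      calc _ = b m * q ^ e m * ∑ j ∈ range 5, (ω ^ (e m - r)) ^ j := by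
            rw [mul_sum]
            refine sum_congr rfl fun j _ ↦ ?_
            rw [mul_zpow, sub_eq_neg_add, zpow_add₀ hω0, mul_pow, ← zpow_natCast (ω ^ e m),
              zpow_comm, zpow_natCast ω]
            ring
        _ = 0 := by rw [this, mul_zero]
    have hF := hasSum_sum fun j (_ : j ∈ range 5) ↦ (hSF j).mul_left ((ω ^ (-r : ℤ)) ^ j)
    have hF0 : ∑ j ∈ range 5, (ω ^ (-r : ℤ)) ^ j * (F ((ω ^ j * q) ^ 5) * S j) = 0 := by
      rw [← mul_zero (F (q ^ 5)), ← hS0, mul_sum]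
      refine sum_congr rfl fun j _ ↦ ?_
      rw [mul_pow, pow_right_comm, hω.pow_eq_one, one_pow, one_mul]
      ring
    rw [hF0] at hF
    have h5 := hF.mul_left (1 / 5)
    rw [mul_zero] at h5
    refine h5.congr_fun fun n ↦ ?_
    have := hsum (n - r)
    calc q ^ n • c n = 1 / 5 * (a n * q ^ n * ∑ j ∈ range 5, (ω ^ (n - r : ℤ)) ^ j) := by
          rw [this]
          by_cases hn : n % 5 = r
          · rw [if_pos (by omega)]
            simp only [c, if_pos hn, smul_eq_mul]
            ring
          · rw [if_neg (by omega)]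
            simp [c, hn]
      _ = _ := by
          rw [mul_sum]
          congr 1
          refine sum_congr rfl fun j _ ↦ ?_
          rw [mul_pow, sub_eq_neg_add, zpow_add₀ hω0, mul_pow, zpow_natCast, pow_right_comm ω n]
          ring
  have hp : HasFPowerSeriesAt (fun _ : ℂ ↦ (0 : ℂ)) (FormalMultilinearSeries.ofScalars ℂ c) 0 := by
    rw [hasFPowerSeriesAt_iff]
    filter_upwards [Metric.ball_mem_nhds (0 : ℂ) one_pos] with q hq
    simpa [FormalMultilinearSeries.coeff_ofScalars] using hc q (by simpa using hq)
  calc a n = (FormalMultilinearSeries.ofScalars ℂ c).coeff n := by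
        simp [c, hn, FormalMultilinearSeries.coeff_ofScalars]
    _ = 0 := by rw [hp.eq_zero]; rfl

end Coefficients

theorem stmt_16 : ∀ α : ℕ → ℂ,
    (∀ q : ℂ, ‖q‖ < 1 →
      HasSum (fun n : ℕ => α n * q ^ n)
        ((qp q (q ^ 5) * qp (q ^ 4) (q ^ 5)) ^ 2 * (qp (-(q ^ 4)) (q ^ 10) * qp (-(q ^ 6)) (q ^ 10)) /
          ((qp (q ^ 2) (q ^ 5) * qp (q ^ 3) (q ^ 5)) ^ 2 * (qp (-(q ^ 2)) (q ^ 10) * qp (-(q ^ 8)) (q ^ 10))))) →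
    ∀ n : ℕ, α (10 * n + 3) = 0 ∧ α (10 * n + 7) = 0 := by 
  intro α hα n
  set F : ℂ → ℂ := fun x ↦ qp (x ^ 4) (x ^ 4) ^ 3 / qp (x ^ 2) (x ^ 2) ^ 4 with hF
  set a : ℕ → ℂ := fun n ↦ α n - α n * (-1) ^ n with ha
  have key (q : ℂ) (hq0 : q ≠ 0) (hq : ‖q‖ < 1) :
      ∃ S : ℂ, HasSum (fun m : ℤ ↦ (-4 * (-1) ^ m) * q ^ (6 * m ^ 2 - 2 * m + 1)) S ∧
        HasSum (fun n ↦ a n * q ^ n) (F (q ^ 5) * S) := by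
    refine ⟨-4 * q * qp (q ^ 4) (q ^ 4), ?_, ?_⟩
    · refine ((hasSum_qp_self hq0 hq).mul_left (-4 * q)).congr_fun fun m ↦ ?_
      rw [zpow_add_one₀ hq0]
      ring
    · have h1 := (hα q hq).sub (hα (-q) (by rwa [norm_neg]))
      change HasSum _ (rrQuotient q - rrQuotient (-q)) at h1
      rw [rrQuotient_sub_rrQuotient_neg hq0 hq] at h1
      simp only [hF, ha, ← pow_mul]
      refine h1.congr_fun fun n ↦ ?_
      rw [neg_pow q]
      ring
  have hmod (m : ℤ) : (6 * m ^ 2 - 2 * m + 1) % 5 = 0 ∨ (6 * m ^ 2 - 2 * m + 1) % 5 = 1 ∨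
      (6 * m ^ 2 - 2 * m + 1) % 5 = 4 := by
    have hm : m % 5 = 0 ∨ m % 5 = 1 ∨ m % 5 = 2 ∨ m % 5 = 3 ∨ m % 5 = 4 := by omega
    rcases hm with h | h | h | h | h <;> simp [pow_two, Int.add_emod, Int.sub_emod, Int.mul_emod, h]
  constructor
  · have h := coeff_eq_zero_of_hasSum (a := a) (F := F) (b := fun m ↦ -4 * (-1) ^ m)
      (e := fun m ↦ 6 * m ^ 2 - 2 * m + 1) (r := 3) (n := 10 * n + 3) (by norm_num) (by norm_num)
      (fun m h ↦ by have := hmod m; unfold Int.ModEq at h; omega) key (by omega)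
    simp only [ha] at h
    rw [Odd.neg_one_pow ⟨5 * n + 1, by ring⟩] at h
    linear_combination h / 2
  · have h := coeff_eq_zero_of_hasSum (a := a) (F := F) (b := fun m ↦ -4 * (-1) ^ m)
      (e := fun m ↦ 6 * m ^ 2 - 2 * m + 1) (r := 2) (n := 10 * n + 7) (by norm_num) (by norm_num)
      (fun m h ↦ by have := hmod m; unfold Int.ModEq at h; omega) key (by omega)
    simp only [ha] at h
    rw [Odd.neg_one_pow ⟨5 * n + 3, by ring⟩] at h
    linear_combination h / 2
end

section
/- Define γ(n) by ∑_{n≥0} γ(n) q^n = (-q,-q^4;q^5)_∞^2 (q^4,q^6;q^{10})_∞ / ((-q^2,-q^3;q^5)_∞^2 (q^3,q^7;q^{10})_∞). Then γ(5n+4)=0 for all n≥0. -/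
namespace ThetaSeries

open Filter Topology

section Pochhammer

lemma summable_norm_mul_pow {q : ℂ} (hq : ‖q‖ < 1) (a : ℂ) :
    Summable fun k : ℕ => ‖-(a * q ^ k)‖ := by
  simpa [norm_mul, norm_pow] using
    (summable_geometric_of_lt_one (norm_nonneg q) hq).mul_left ‖a‖

lemma multipliable_qp {q : ℂ} (hq : ‖q‖ < 1) (a : ℂ) :
    Multipliable fun k : ℕ => 1 - a * q ^ k := by
  simpa [sub_eq_add_neg] using multipliable_one_add_of_summable (summable_norm_mul_pow hq a)

lemma qp_ne_zero {a q : ℂ} (ha : ‖a‖ < 1) (hq : ‖q‖ < 1) : qp a q ≠ 0 := by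
  have h := tprod_one_add_ne_zero_of_summable (f := fun k : ℕ => -(a * q ^ k)) (fun k h0 => by
    have h1 : a * q ^ k = 1 := by linear_combination -h0
    have h2 : ‖a * q ^ k‖ < 1 := by
      rw [norm_mul, norm_pow]
      exact mul_lt_one_of_nonneg_of_lt_one_left (norm_nonneg a) ha
        (pow_le_one₀ (norm_nonneg q) hq.le)
    rw [h1, norm_one] at h2
    exact lt_irrefl _ h2) (summable_norm_mul_pow hq a)
  simpa [qp, sub_eq_add_neg] using h

lemma qp_one (q : ℂ) : qp 1 q = 0 :=
  tprod_of_exists_eq_zero ⟨0, by simp⟩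

lemma qp_mul_qp_neg {q : ℂ} (hq : ‖q‖ < 1) (a : ℂ) :
    qp a q * qp (-a) q = qp (a ^ 2) (q ^ 2) := by
  rw [qp, qp, qp, ← (multipliable_qp hq a).tprod_mul (multipliable_qp hq (-a))]
  exact tprod_congr fun k => by ring

/-- Coefficients of Euler's expansion of `(x;Q)_∞` in powers of `x`. -/
noncomputable def eulerCoeff (Q : ℂ) (n : ℕ) : ℂ :=
  ∏ k ∈ Finset.range n, (-Q ^ k / (1 - Q ^ (k + 1)))

lemma one_sub_pow_ne_zero {Q : ℂ} (hQ : ‖Q‖ < 1) (n : ℕ) : 1 - Q ^ (n + 1) ≠ 0 := by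
  intro h
  have h1 : ‖Q ^ (n + 1)‖ < 1 := by
    rw [norm_pow]
    exact pow_lt_one₀ (norm_nonneg Q) hQ n.succ_ne_zero
  rw [← sub_eq_zero.1 h, norm_one] at h1
  exact lt_irrefl _ h1

lemma eulerCoeff_succ {Q : ℂ} (hQ : ‖Q‖ < 1) (n : ℕ) :
    (1 - Q ^ (n + 1)) * eulerCoeff Q (n + 1) = -Q ^ n * eulerCoeff Q n := by
  have := one_sub_pow_ne_zero hQ n
  rw [eulerCoeff, Finset.prod_range_succ, ← eulerCoeff]
  field_simp

lemma eulerCoeff_ne_zero {Q : ℂ} (hQ0 : Q ≠ 0) (hQ : ‖Q‖ < 1) (n : ℕ) : eulerCoeff Q n ≠ 0 :=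
  Finset.prod_ne_zero_iff.2 fun k _ =>
    div_ne_zero (neg_ne_zero.2 (pow_ne_zero _ hQ0)) (one_sub_pow_ne_zero hQ k)

lemma summable_eulerCoeff {Q : ℂ} (hQ0 : Q ≠ 0) (hQ : ‖Q‖ < 1) (x : ℂ) :
    Summable fun n => eulerCoeff Q n * x ^ n := by
  rcases eq_or_ne x 0 with rfl | hx
  · exact summable_of_ne_finset_zero (s := {0}) fun n hn => by
      simp [show n ≠ 0 by simpa using hn]
  have hpow := tendsto_pow_atTop_nhds_zero_of_norm_lt_one hQ
  have hlim : Tendsto (fun n : ℕ => ‖-Q ^ n / (1 - Q ^ (n + 1)) * x‖) atTop (𝓝 0) := by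
    have := ((hpow.neg.div (tendsto_const_nhds.sub (hpow.comp (tendsto_add_atTop_nat 1)))
      (by simp : (1 : ℂ) - 0 ≠ 0)).mul_const x).norm
    simpa using this
  refine summable_of_ratio_test_tendsto_lt_one zero_lt_one
    (Eventually.of_forall fun n => mul_ne_zero (eulerCoeff_ne_zero hQ0 hQ n) (pow_ne_zero n hx))
    (hlim.congr fun n => ?_)
  rw [← norm_div]
  congr 1
  have h1 := eulerCoeff_ne_zero hQ0 hQ n
  have h2 := one_sub_pow_ne_zero hQ n
  rw [eulerCoeff, Finset.prod_range_succ, ← eulerCoeff]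
  field_simp
  ring

lemma tsum_eulerCoeff_step {Q : ℂ} (hQ0 : Q ≠ 0) (hQ : ‖Q‖ < 1) (x : ℂ) :
    ∑' n, eulerCoeff Q n * x ^ n = (1 - x) * ∑' n, eulerCoeff Q n * (x * Q) ^ n := by
  have hs := summable_eulerCoeff hQ0 hQ
  have h1 := (hs x).sub (hs (x * Q))
  have h2 : ∑' n, (eulerCoeff Q n * x ^ n - eulerCoeff Q n * (x * Q) ^ n)
      = -x * ∑' n, eulerCoeff Q n * (x * Q) ^ n := by
    rw [h1.tsum_eq_zero_add, ← tsum_mul_left]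
    simp only [pow_zero, sub_self, zero_add]
    refine tsum_congr fun n => ?_
    have := eulerCoeff_succ hQ n
    rw [mul_pow, mul_pow]
    linear_combination x ^ (n + 1) * this
  rw [(hs x).tsum_sub (hs (x * Q))] at h2
  linear_combination h2

lemma tsum_eulerCoeff {Q : ℂ} (hQ0 : Q ≠ 0) (hQ : ‖Q‖ < 1) (x : ℂ) :
    ∑' n, eulerCoeff Q n * x ^ n = qp x Q := by
  have hstep : ∀ N : ℕ, ∑' n, eulerCoeff Q n * x ^ n =
      (∏ k ∈ Finset.range N, (1 - x * Q ^ k)) * ∑' n, eulerCoeff Q n * (x * Q ^ N) ^ n := by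
    intro N
    induction N with
    | zero => simp
    | succ N ih =>
      rw [ih, tsum_eulerCoeff_step hQ0 hQ, Finset.prod_range_succ, pow_succ, mul_assoc,
        mul_assoc]
  have harg : Tendsto (fun N : ℕ => x * Q ^ N) atTop (𝓝 0) := by
    simpa using (tendsto_pow_atTop_nhds_zero_of_norm_lt_one hQ).const_mul x
  have hsum : Tendsto (fun N : ℕ => ∑' n, eulerCoeff Q n * (x * Q ^ N) ^ n) atTop
      (𝓝 (∑' n, eulerCoeff Q n * 0 ^ n)) := by
    refine tendsto_tsum_of_dominated_convergence (bound := fun n => ‖eulerCoeff Q n * x ^ n‖)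
      (summable_eulerCoeff hQ0 hQ x).norm (fun n => (harg.pow n).const_mul _)
      (Eventually.of_forall fun N n => ?_)
    rw [norm_mul, norm_mul, norm_pow, norm_pow, norm_mul, norm_pow]
    gcongr
    exact mul_le_of_le_one_right (norm_nonneg x) (pow_le_one₀ (norm_nonneg Q) hQ.le)
  have hzero : ∑' n, eulerCoeff Q n * (0 : ℂ) ^ n = 1 := by
    rw [tsum_eq_single 0 fun n hn => by simp [hn]]
    simp [eulerCoeff]
  have hlim := (multipliable_qp hQ x).tendsto_prod_tprod_nat.mul hsum
  rw [hzero, mul_one] at hlim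
  exact tendsto_nhds_unique (tendsto_const_nhds.congr hstep) hlim

end Pochhammer

section Convolution

variable {f g : ℤ → ℂ}

/-- The shear `(N, m) ↦ (N - m, m)` of the lattice `ℤ × ℤ`. -/
def shear : ℤ × ℤ ≃ ℤ × ℤ where
  toFun p := (p.1 - p.2, p.2)
  invFun p := (p.1 + p.2, p.2)
  left_inv p := by simp
  right_inv p := by simp

lemma summable_shear (hf : Summable f) (hg : Summable g) :
    Summable fun p : ℤ × ℤ => f (p.1 - p.2) * g p.2 :=
  (shear.summable_iff (f := fun p : ℤ × ℤ => f p.1 * g p.2)).2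
    (summable_mul_of_summable_norm hf.norm hg.norm)

lemma summable_conv_fiber (hf : Summable f) (hg : Summable g) (N : ℤ) :
    Summable fun m => f (N - m) * g m :=
  (summable_shear hf hg).prod_factor N

lemma hasSum_conv (hf : Summable f) (hg : Summable g) :
    HasSum (fun N => ∑' m, f (N - m) * g m) ((∑' n, f n) * ∑' m, g m) := by
  have hs := summable_shear hf hg
  rw [tsum_mul_tsum_of_summable_norm hf.norm hg.norm,
    ← shear.tsum_eq (fun p : ℤ × ℤ => f p.1 * g p.2)]
  exact hs.hasSum.prod_fiberwise fun N => (hs.prod_factor N).hasSum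

end Convolution

section TripleProduct

/-- `(-1)^m Q^{m(m-1)/2}`, the coefficients of the theta series. -/
noncomputable def tri (Q : ℂ) (m : ℤ) : ℂ := (-1) ^ m * Q ^ (m * (m - 1) / 2)

lemma two_mul_tri_exponent (m : ℤ) : 2 * (m * (m - 1) / 2) = m * (m - 1) :=
  Int.mul_ediv_cancel' (Int.even_mul_pred_self m).two_dvd

lemma tri_zero (Q : ℂ) : tri Q 0 = 1 := by simp [tri]

lemma tri_succ {Q : ℂ} (hQ0 : Q ≠ 0) (m : ℤ) : tri Q (m + 1) = -Q ^ m * tri Q m := by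
  have h : (m + 1) * (m + 1 - 1) / 2 = m + m * (m - 1) / 2 := by
    have h1 := two_mul_tri_exponent m
    have h2 := two_mul_tri_exponent (m + 1)
    linarith
  rw [tri, tri, h, zpow_add₀ hQ0, zpow_add₀ (by norm_num : (-1 : ℂ) ≠ 0)]
  simp only [zpow_one]
  ring

lemma eq_tri_of_succ {Q b : ℂ} (hQ0 : Q ≠ 0) (hb : b ≠ 0) {c : ℤ → ℂ}
    (hc : ∀ N, c (N + 1) = -(b * Q ^ N) * c N) (N : ℤ) : c N = c 0 * (b ^ N * tri Q N) := by
  induction N using Int.induction_on with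
  | zero => simp [tri_zero]
  | succ n ih =>
    rw [hc, ih, tri_succ hQ0, zpow_add_one₀ hb]
    ring
  | pred n ih =>
    have h1 := hc (-n - 1)
    have h2 := tri_succ hQ0 (-n - 1)
    rw [sub_add_cancel] at h1 h2
    have h3 : b ^ (-n : ℤ) = b ^ (-n - 1 : ℤ) * b := by
      rw [← zpow_add_one₀ hb, sub_add_cancel]
    rw [h1, h2, h3] at ih
    refine mul_left_cancel₀ (neg_ne_zero.2 (mul_ne_zero hb (zpow_ne_zero (-n - 1 : ℤ) hQ0))) ?_
    linear_combination ih

/-- Euler's coefficients extended by zero to negative indices. -/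
noncomputable def eulerCoeffInt (Q : ℂ) (n : ℤ) : ℂ := if 0 ≤ n then eulerCoeff Q n.toNat else 0

lemma eulerCoeffInt_rec {Q : ℂ} (hQ : ‖Q‖ < 1) (n : ℤ) :
    (1 - Q ^ (n + 1)) * eulerCoeffInt Q (n + 1) = -Q ^ n * eulerCoeffInt Q n := by
  rcases lt_trichotomy n (-1) with h | rfl | h
  · rw [eulerCoeffInt, eulerCoeffInt, if_neg (by omega), if_neg (by omega)]
    simp
  · simp [eulerCoeffInt]
  · lift n to ℕ using by omega
    have := eulerCoeff_succ hQ n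
    rw [eulerCoeffInt, eulerCoeffInt, if_pos (by omega), if_pos (by omega)]
    simpa [← zpow_natCast] using this

lemma hasSum_eulerCoeffInt {Q : ℂ} (hQ0 : Q ≠ 0) (hQ : ‖Q‖ < 1) (x : ℂ) :
    HasSum (fun n : ℤ => eulerCoeffInt Q n * x ^ n) (qp x Q) := by
  refine (Function.Injective.hasSum_iff (Nat.cast_injective (R := ℤ)) fun n hn => ?_).1 ?_
  · rw [eulerCoeffInt, if_neg, zero_mul]
    exact fun h => hn ⟨n.toNat, Int.toNat_of_nonneg h⟩
  · rw [← tsum_eulerCoeff hQ0 hQ]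
    convert (summable_eulerCoeff hQ0 hQ x).hasSum using 2 with n
    simp [eulerCoeffInt]

/-- Laurent coefficients of `(x;Q)_∞ (Q/x;Q)_∞`. -/
noncomputable def prodCoeff (Q : ℂ) (N : ℤ) : ℂ :=
  ∑' m : ℤ, eulerCoeffInt Q (N - m) * (eulerCoeffInt Q (-m) * Q ^ (-m))

lemma hasSum_eulerCoeffInt_inv {Q x : ℂ} (hQ0 : Q ≠ 0) (hQ : ‖Q‖ < 1) :
    HasSum (fun m : ℤ => eulerCoeffInt Q (-m) * Q ^ (-m) * x ^ m) (qp (Q / x) Q) := by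
  rw [← (Equiv.neg ℤ).hasSum_iff]
  refine (hasSum_eulerCoeffInt hQ0 hQ (Q / x)).congr_fun fun m => ?_
  simp only [Function.comp_apply, Equiv.neg_apply, neg_neg, zpow_neg _ m, div_zpow]
  ring

lemma hasSum_prodCoeff {Q x : ℂ} (hQ0 : Q ≠ 0) (hQ : ‖Q‖ < 1) (hx : x ≠ 0) :
    HasSum (fun N => prodCoeff Q N * x ^ N) (qp x Q * qp (Q / x) Q) := by
  have h1 := hasSum_eulerCoeffInt hQ0 hQ x
  have h2 := hasSum_eulerCoeffInt_inv (x := x) hQ0 hQ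
  have h := hasSum_conv h1.summable h2.summable
  rw [h1.tsum_eq, h2.tsum_eq] at h
  convert h using 2 with N
  rw [prodCoeff, ← tsum_mul_right]
  refine tsum_congr fun m => ?_
  rw [zpow_sub₀ hx]
  have := zpow_ne_zero m hx
  field_simp

lemma summable_prodCoeff_term {Q : ℂ} (hQ0 : Q ≠ 0) (hQ : ‖Q‖ < 1) (N : ℤ) :
    Summable fun m : ℤ => eulerCoeffInt Q (N - m) * (eulerCoeffInt Q (-m) * Q ^ (-m)) := by
  simpa only [one_zpow, mul_one] using summable_conv_fiber
    (hasSum_eulerCoeffInt hQ0 hQ 1).summable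
    (hasSum_eulerCoeffInt_inv (x := 1) hQ0 hQ).summable N

lemma prodCoeff_defect {Q : ℂ} (hQ0 : Q ≠ 0) (hQ : ‖Q‖ < 1) (N : ℤ) :
    prodCoeff Q (N + 1) + Q ^ N * prodCoeff Q N
      = prodCoeff Q (N + 2) + Q ^ (N + 1) * prodCoeff Q (N + 1) := by
  have hs := summable_prodCoeff_term hQ0 hQ
  have hshift : prodCoeff Q (N + 2) = ∑' m : ℤ, eulerCoeffInt Q (N + 2 - (m + 1)) *
      (eulerCoeffInt Q (-(m + 1)) * Q ^ (-(m + 1))) :=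
    ((Equiv.addRight (1 : ℤ)).tsum_eq _).symm
  have hs' : Summable fun m : ℤ => eulerCoeffInt Q (N + 2 - (m + 1)) *
      (eulerCoeffInt Q (-(m + 1)) * Q ^ (-(m + 1))) :=
    (Equiv.addRight (1 : ℤ)).summable_iff.2 (hs (N + 2))
  rw [hshift]
  simp only [prodCoeff, ← tsum_mul_left]
  rw [← (hs (N + 1)).tsum_add ((hs N).mul_left _), ← hs'.tsum_add ((hs (N + 1)).mul_left _)]
  refine tsum_congr fun m => ?_
  have e1 := eulerCoeffInt_rec hQ (N - m)
  have e2 := eulerCoeffInt_rec hQ (-(m + 1))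
  rw [show N - m + 1 = N + 1 - m by ring, show N + 1 - m = N + 1 + -m by ring] at e1
  rw [show -(m + 1) + 1 = -m by ring] at e2
  rw [show N + 2 - (m + 1) = N + 1 - m by ring, show N + 1 - m = N + 1 + -m by ring]
  rw [show N - m = N + -m by ring] at e1 ⊢
  rw [zpow_add₀ hQ0] at e1
  rw [zpow_add₀ hQ0 N (-m)] at e1
  linear_combination eulerCoeffInt Q (-m) * e1 - eulerCoeffInt Q (N + 1 + -m) * e2

lemma prodCoeff_succ {Q : ℂ} (hQ0 : Q ≠ 0) (hQ : ‖Q‖ < 1) (N : ℤ) :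
    prodCoeff Q (N + 1) = -Q ^ N * prodCoeff Q N := by
  set d : ℤ → ℂ := fun N => prodCoeff Q (N + 1) + Q ^ N * prodCoeff Q N with hd
  have hstep : ∀ N, d N = d (N + 1) := fun N => by
    simpa [hd, add_assoc] using prodCoeff_defect hQ0 hQ N
  have hconst : ∀ k : ℕ, d N = d (N + k) := fun k => by
    induction k with
    | zero => simp
    | succ k ih => rw [ih, hstep]; push_cast; rw [add_assoc]
  have hsum : Summable d := by
    have h1 := (hasSum_prodCoeff hQ0 hQ one_ne_zero).summable
    have h2 := (hasSum_prodCoeff hQ0 hQ hQ0).summable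
    have h3 := (Equiv.addRight (1 : ℤ)).summable_iff.2 h1
    refine (h3.add h2).congr fun n => ?_
    simp [hd, mul_comm]
  have hinj : Function.Injective fun k : ℕ => N + (k : ℤ) := fun a b h => by simpa using h
  have hlim := (hsum.comp_injective hinj).tendsto_atTop_zero
  have h0 : d N = 0 := tendsto_nhds_unique (tendsto_const_nhds.congr hconst) hlim
  simp only [hd] at h0
  linear_combination h0

/-- The Jacobi triple product, up to a nonzero factor depending only on `Q`. -/
theorem exists_hasSum_tri {Q : ℂ} (hQ0 : Q ≠ 0) (hQ : ‖Q‖ < 1) :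
    ∃ C : ℂ, C ≠ 0 ∧ ∀ x : ℂ, x ≠ 0 →
      HasSum (fun m : ℤ => tri Q m * x ^ m) (C * (qp x Q * qp (Q / x) Q)) := by
  have hc : ∀ N, prodCoeff Q N = prodCoeff Q 0 * tri Q N := fun N => by
    simpa only [one_zpow, one_mul] using eq_tri_of_succ hQ0 one_ne_zero (c := prodCoeff Q)
      (fun N => by simpa only [one_mul] using prodCoeff_succ hQ0 hQ N) N
  have h0 : prodCoeff Q 0 ≠ 0 := by
    intro h0
    obtain ⟨x, hx⟩ := IsAlgClosed.exists_pow_nat_eq Q (n := 2) (by norm_num)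
    have hx0 : x ≠ 0 := by rintro rfl; exact hQ0 (by simpa using hx.symm)
    have hxn : ‖x‖ < 1 := by
      rw [← hx, norm_pow] at hQ
      exact (pow_lt_one_iff_of_nonneg (norm_nonneg x) two_ne_zero).1 hQ
    have hx1 : qp x Q ≠ 0 := qp_ne_zero hxn hQ
    have hx2 : qp (Q / x) Q ≠ 0 := by
      rwa [← hx, pow_two, mul_div_cancel_right₀ _ hx0, ← pow_two, hx]
    have h1 := hasSum_prodCoeff hQ0 hQ hx0
    have h2 : ∀ N, prodCoeff Q N * x ^ N = 0 := fun N => by rw [hc N, h0, zero_mul, zero_mul]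
    simp only [h2] at h1
    exact mul_ne_zero hx1 hx2 (h1.unique hasSum_zero)
  refine ⟨(prodCoeff Q 0)⁻¹, inv_ne_zero h0, fun x hx => ?_⟩
  refine ((hasSum_prodCoeff hQ0 hQ hx).mul_left (prodCoeff Q 0)⁻¹).congr_fun fun m => ?_
  rw [hc m]
  field_simp

end TripleProduct

section Lambert

lemma tendsto_norm_ratio {Q y : ℂ} (hQ : ‖Q‖ < 1) {α β : ℂ} (hα : α ≠ 0) :
    Tendsto (fun n : ℕ => ‖y * ((α - β * Q ^ n) / (α - β * Q ^ (n + 1)))‖) atTop (𝓝 ‖y‖) := by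
  have hpow := tendsto_pow_atTop_nhds_zero_of_norm_lt_one hQ
  have hden := fun {f : ℕ → ℂ} (hf : Tendsto f atTop (𝓝 0)) =>
    (tendsto_const_nhds (x := α)).sub (hf.const_mul β)
  have h := (((hden hpow).div (hden (hpow.comp (tendsto_add_atTop_nat 1)))
    (by simpa using hα)).const_mul y).norm
  simpa [hα] using h

lemma summable_geometric_div {Q y α β : ℂ} (hQ : ‖Q‖ < 1) (hy0 : y ≠ 0) (hy : ‖y‖ < 1)
    (hα : α ≠ 0) (h : ∀ n : ℕ, α - β * Q ^ n ≠ 0) :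
    Summable fun n : ℕ => y ^ n / (α - β * Q ^ n) := by
  refine summable_of_ratio_test_tendsto_lt_one hy
    (Eventually.of_forall fun n => div_ne_zero (pow_ne_zero n hy0) (h n))
    ((tendsto_norm_ratio hQ (β := β) hα).congr fun n => ?_)
  rw [← norm_div]
  congr 1
  have h1 := h n
  have h2 := h (n + 1)
  field_simp
  ring

variable {Q a b : ℂ}

lemma neg_lambert_term (hQ0 : Q ≠ 0) (a b : ℂ) (n : ℕ) :
    a ^ (-((n : ℤ) + 1)) / (1 - b * Q ^ (-((n : ℤ) + 1)))
      = (Q / a) * ((Q / a) ^ n / (-b - (-Q) * Q ^ n)) := by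
  have h1 : Q ^ (-((n : ℤ) + 1)) = (Q ^ (n + 1))⁻¹ := by
    rw [zpow_neg]; norm_cast
  have h2 : a ^ (-((n : ℤ) + 1)) = (a ^ (n + 1))⁻¹ := by
    rw [zpow_neg]; norm_cast
  have h3 := pow_ne_zero (n + 1) hQ0
  rw [h1, h2, show 1 - b * (Q ^ (n + 1))⁻¹ = (-b - (-Q) * Q ^ n) / Q ^ (n + 1) by
    field_simp; ring, ← mul_div_assoc, ← pow_succ', div_pow]
  simp only [div_eq_mul_inv, mul_inv, inv_inv]
  ring

lemma summable_lambert (hQ0 : Q ≠ 0) (hQ : ‖Q‖ < 1) (ha : ‖Q‖ < ‖a‖) (ha1 : ‖a‖ < 1)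
    (hb : b ≠ 0) (h : ∀ n : ℤ, 1 - b * Q ^ n ≠ 0) :
    Summable fun n : ℤ => a ^ n / (1 - b * Q ^ n) := by
  have ha0 : a ≠ 0 := norm_pos_iff.1 ((norm_nonneg Q).trans_lt ha)
  refine Summable.of_nat_of_neg_add_one ?_ ?_
  · simpa using summable_geometric_div hQ ha0 ha1 one_ne_zero fun n => by simpa using h n
  · simp only [neg_lambert_term hQ0]
    refine (summable_geometric_div hQ (div_ne_zero hQ0 ha0) ?_ (neg_ne_zero.2 hb)
      fun n h0 => h (-((n : ℤ) + 1)) ?_).mul_left _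
    · rwa [norm_div, div_lt_one ((norm_nonneg Q).trans_lt ha)]
    · rw [zpow_neg, zpow_add_one₀ hQ0, zpow_natCast]
      have := pow_ne_zero n hQ0
      field_simp
      linear_combination h0

/-- The ratio of `∑ aⁿ / (1 - b Qⁿ)` to a quotient of theta series; it is independent of `a`. -/
noncomputable def lambertConst (Q b : ℂ) : ℂ := ∑' m : ℤ, tri Q m / (1 - b * Q ^ (-m))

theorem lambert_mul_theta (hQ0 : Q ≠ 0) (hQ : ‖Q‖ < 1) (ha : ‖Q‖ < ‖a‖) (ha1 : ‖a‖ < 1)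
    (hb : b ≠ 0) (h : ∀ n : ℤ, 1 - b * Q ^ n ≠ 0) :
    (∑' n : ℤ, a ^ n / (1 - b * Q ^ n)) * ∑' m : ℤ, tri Q m * a ^ m
      = lambertConst Q b * ∑' m : ℤ, tri Q m * (a * b) ^ m := by
  have ha0 : a ≠ 0 := norm_pos_iff.1 ((norm_nonneg Q).trans_lt ha)
  obtain ⟨C, -, hC⟩ := exists_hasSum_tri hQ0 hQ
  have hL := summable_lambert hQ0 hQ ha ha1 hb h
  have hth := (hC a ha0).summable
  have hterm : ∀ N m : ℤ, a ^ (N - m) / (1 - b * Q ^ (N - m)) * (tri Q m * a ^ m)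
      = a ^ N * (tri Q m / (1 - b * Q ^ (N - m))) := fun N m => by
    rw [zpow_sub₀ ha0]
    have := zpow_ne_zero m ha0
    field_simp
  set c : ℤ → ℂ := fun N => ∑' m : ℤ, tri Q m / (1 - b * Q ^ (N - m)) with hcdef
  have hcs : ∀ N : ℤ, Summable fun m : ℤ => tri Q m / (1 - b * Q ^ (N - m)) := fun N => by
    have h1 := summable_conv_fiber hL hth N
    simp only [hterm] at h1
    exact (summable_mul_left_iff (zpow_ne_zero N ha0)).1 h1
  have hQsum : HasSum (fun m : ℤ => tri Q m * Q ^ m) 0 := by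
    simpa [div_self hQ0, qp_one] using hC Q hQ0
  have hrec : ∀ N, c (N + 1) = -(b * Q ^ N) * c N := fun N => by
    have hshift : c (N + 1) = ∑' m : ℤ, tri Q (m + 1) / (1 - b * Q ^ (N + 1 - (m + 1))) :=
      ((Equiv.addRight (1 : ℤ)).tsum_eq _).symm
    have hsum := ((hcs N).hasSum.mul_left (-(b * Q ^ N))).sub hQsum
    rw [sub_zero] at hsum
    rw [hshift, ← hsum.tsum_eq]
    refine tsum_congr fun m => ?_
    have h1 := h (N - m)
    have h2 := zpow_ne_zero m hQ0
    rw [add_sub_add_right_eq_sub, tri_succ hQ0]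
    have h3 : Q ^ N = Q ^ (N - m) * Q ^ m := by rw [← zpow_add₀ hQ0, sub_add_cancel]
    rw [h3]
    field_simp
    ring
  have h0 : c 0 = lambertConst Q b := by simp [hcdef, lambertConst]
  rw [← (hasSum_conv hL hth).tsum_eq, ← tsum_mul_left]
  refine tsum_congr fun N => ?_
  simp only [hterm]
  rw [tsum_mul_left, ← h0, mul_zpow]
  linear_combination a ^ N * eq_tri_of_succ hQ0 hb hrec N

end Lambert

section Twist

/-- Summing over the orbit of `r` under fifth roots of unity extracts the exponents `≡ 4 mod 5`. -/
lemma hasSum_twist {ι : Type*} {ζ r : ℂ} (hζ : IsPrimitiveRoot ζ 5) {c : ι → ℂ}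
    {e : ι → ℤ} {A : ℂ → ℂ}
    (h : ∀ k < 5, HasSum (fun i => c i * (ζ ^ k * r) ^ e i) (A (ζ ^ k * r))) :
    HasSum (fun i => if 5 ∣ e i + 1 then 5 * (c i * r ^ e i) else 0)
      (∑ k ∈ Finset.range 5, ζ ^ k * A (ζ ^ k * r)) := by
  have hζ0 : ζ ≠ 0 := hζ.ne_zero (by norm_num)
  refine (hasSum_sum fun k hk => (h k (Finset.mem_range.1 hk)).mul_left (ζ ^ k)).congr_fun
    fun i => ?_
  have hterm : ∀ k ∈ Finset.range 5, ζ ^ k * (c i * (ζ ^ k * r) ^ e i)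
      = (ζ ^ (e i + 1)) ^ k * (c i * r ^ e i) := fun k _ => by
    have : (ζ ^ (e i + 1)) ^ k = (ζ ^ k) ^ e i * ζ ^ k := by
      rw [← zpow_natCast, ← zpow_mul, mul_comm, zpow_mul, zpow_natCast,
        zpow_add_one₀ (pow_ne_zero k hζ0)]
    rw [this, mul_zpow]
    ring
  rw [Finset.sum_congr rfl hterm, ← Finset.sum_mul]
  split_ifs with hd
  · rw [(hζ.zpow_eq_one_iff_dvd (e i + 1)).2 hd]
    simp
  · have hne : ζ ^ (e i + 1) - 1 ≠ 0 := fun h0 =>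
      hd ((hζ.zpow_eq_one_iff_dvd (e i + 1)).1 (sub_eq_zero.1 h0))
    have h5 : (ζ ^ (e i + 1)) ^ 5 = 1 := by
      rw [← zpow_natCast, ← zpow_mul, mul_comm, zpow_mul, zpow_natCast, hζ.pow_eq_one, one_zpow]
    have hgeom := geom_sum_mul (ζ ^ (e i + 1)) 5
    rw [h5, sub_self] at hgeom
    rw [(mul_eq_zero.1 hgeom).resolve_right hne, zero_mul]

end Twist

section ThetaPairs

variable {z : ℂ}

lemma neg_one_zpow_mul_self (n : ℤ) : ((-1 : ℂ) ^ n) * (-1) ^ n = 1 := by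
  rw [← mul_zpow]; simp

lemma tri_pow (r : ℂ) (k : ℕ) (n : ℤ) :
    tri (r ^ k) n = (-1) ^ n * r ^ (k * (n * (n - 1) / 2) : ℤ) := by
  rw [tri, zpow_mul, zpow_natCast]

lemma hasSum_theta_mul {P Q x y A B : ℂ} (hA : HasSum (fun n => tri P n * x ^ n) A)
    (hB : HasSum (fun m => tri Q m * y ^ m) B) :
    HasSum (fun p : ℤ × ℤ => tri P p.1 * x ^ p.1 * (tri Q p.2 * y ^ p.2)) (A * B) := by
  have h := summable_mul_of_summable_norm hA.summable.norm hB.summable.norm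
  have h2 := tsum_mul_tsum_of_summable_norm hA.summable.norm hB.summable.norm
  rw [hA.tsum_eq, hB.tsum_eq] at h2
  rw [h2]
  exact h.hasSum

/-- A reflection of the sublattice `n + 2m ≡ 4 mod 5`, extended by the identity. -/
def reflect (p : ℤ × ℤ) : ℤ × ℤ :=
  if 5 ∣ p.1 + 2 * p.2 + 1 then
    (p.1 + 2 + 4 * ((p.2 - 2 - 2 * p.1) / 5), p.2 - 1 - 2 * ((p.2 - 2 - 2 * p.1) / 5))
  else p

lemma reflect_of_dvd {n i : ℤ} :
    reflect (n, 2 + 2 * n + 5 * i) = (n + 2 + 4 * i, 1 + 2 * n + 3 * i) := by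
  rw [reflect, if_pos (by dsimp only; omega)]
  ext <;> dsimp only <;> omega

lemma exists_of_dvd {p : ℤ × ℤ} (h : 5 ∣ p.1 + 2 * p.2 + 1) :
    ∃ n i : ℤ, p = (n, 2 + 2 * n + 5 * i) :=
  ⟨p.1, (p.2 - 2 - 2 * p.1) / 5, by ext <;> dsimp only; omega⟩

lemma reflect_involutive : Function.Involutive reflect := by
  intro p
  by_cases h : 5 ∣ p.1 + 2 * p.2 + 1
  · obtain ⟨n, i, rfl⟩ := exists_of_dvd h
    rw [reflect_of_dvd, show 1 + 2 * n + 3 * i = 2 + 2 * (n + 2 + 4 * i) + 5 * (-1 - i) by ring,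
      reflect_of_dvd]
    ext <;> dsimp only <;> ring
  · have : reflect p = p := if_neg h
    rw [this, this]

lemma theta_pair_reflect {r : ℂ} (hr : r ≠ 0) (n i : ℤ) :
    tri (r ^ 5) (n + 2 + 4 * i) * (-1) ^ (n + 2 + 4 * i) * tri (r ^ 5) (1 + 2 * n + 3 * i) *
        r ^ (n + 2 + 4 * i + 2 * (1 + 2 * n + 3 * i))
      = -(tri (r ^ 5) n * (-1) ^ n * tri (r ^ 5) (2 + 2 * n + 5 * i) *
        r ^ (n + 2 * (2 + 2 * n + 5 * i))) := by
  have hform : ∀ a b : ℤ, tri (r ^ 5) a * (-1) ^ a * tri (r ^ 5) b * r ^ (a + 2 * b)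
      = (-1) ^ b * r ^ (5 * (a * (a - 1) / 2) + 5 * (b * (b - 1) / 2) + (a + 2 * b)) := by
    intro a b
    rw [tri_pow, tri_pow, zpow_add₀ hr (_ + _) (a + 2 * b), zpow_add₀ hr (5 * _)]
    push_cast
    linear_combination (r ^ (5 * (a * (a - 1) / 2)) * (-1) ^ b * r ^ (5 * (b * (b - 1) / 2))
      * r ^ (a + 2 * b)) * neg_one_zpow_mul_self a
  rw [hform, hform]
  have hsign : (-1 : ℂ) ^ (1 + 2 * n + 3 * i) = -(-1) ^ (2 + 2 * n + 5 * i) := by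
    rw [show 2 + 2 * n + 5 * i = 1 + 2 * n + 3 * i + (2 * i + 1) by ring,
      zpow_add₀ (by norm_num : (-1 : ℂ) ≠ 0) (1 + 2 * n + 3 * i),
      (odd_two_mul_add_one i).neg_one_zpow]
    ring
  have hexp : ∀ a b a' b' : ℤ, 5 * (a * (a - 1)) + 5 * (b * (b - 1)) + 2 * (a + 2 * b)
      = 5 * (a' * (a' - 1)) + 5 * (b' * (b' - 1)) + 2 * (a' + 2 * b') →
      5 * (a * (a - 1) / 2) + 5 * (b * (b - 1) / 2) + (a + 2 * b)
      = 5 * (a' * (a' - 1) / 2) + 5 * (b' * (b' - 1) / 2) + (a' + 2 * b') := by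
    intro a b a' b' h
    have h1 := two_mul_tri_exponent a
    have h2 := two_mul_tri_exponent b
    have h3 := two_mul_tri_exponent a'
    have h4 := two_mul_tri_exponent b'
    linarith
  rw [hsign, hexp (n + 2 + 4 * i) (1 + 2 * n + 3 * i) n (2 + 2 * n + 5 * i) (by ring)]
  ring

lemma theta_pair_twist_eq_zero {ζ r : ℂ} (hζ : IsPrimitiveRoot ζ 5) (hr : r ≠ 0) {A : ℂ → ℂ}
    (hA : ∀ x, x ≠ 0 → HasSum (fun n => tri (r ^ 5) n * x ^ n) (A x)) :
    ∑ k ∈ Finset.range 5, ζ ^ k * (A (-(ζ ^ k * r)) * A ((ζ ^ k * r) ^ 2)) = 0 := by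
  have hζ0 : ζ ≠ 0 := hζ.ne_zero (by norm_num)
  have h : HasSum _ (∑ k ∈ Finset.range 5, ζ ^ k * (A (-(ζ ^ k * r)) * A ((ζ ^ k * r) ^ 2))) :=
    hasSum_twist hζ (A := fun z => A (-z) * A (z ^ 2))
      (c := fun p : ℤ × ℤ => tri (r ^ 5) p.1 * (-1) ^ p.1 * tri (r ^ 5) p.2)
      (e := fun p => p.1 + 2 * p.2) fun k _ => by
        have hz : ζ ^ k * r ≠ 0 := mul_ne_zero (pow_ne_zero k hζ0) hr
        refine (hasSum_theta_mul (hA _ (neg_ne_zero.2 hz)) (hA _ (pow_ne_zero 2 hz))).congr_fun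
          fun p => ?_
        rw [zpow_add₀ hz, zpow_mul, neg_eq_neg_one_mul (ζ ^ k * r), mul_zpow (-1)]
        norm_cast
        ring
  refine self_eq_neg.1 (((Equiv.hasSum_iff reflect_involutive.toPerm).2 h).unique
    (h.neg.congr_fun fun p => ?_))
  dsimp only [Function.comp_apply, Function.Involutive.coe_toPerm]
  by_cases hp : 5 ∣ p.1 + 2 * p.2 + 1
  · rw [if_pos hp]
    obtain ⟨n, i, rfl⟩ := exists_of_dvd hp
    rw [reflect_of_dvd, if_pos (by dsimp only; omega), theta_pair_reflect hr]
    ring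
  · rw [show reflect p = p from if_neg hp, if_neg hp, neg_zero]

/-- Splitting a product of two theta series according to the parity of the summation indices. -/
lemma theta_parity (hz : z ≠ 0) {A B : ℂ → ℂ}
    (hA : ∀ x, x ≠ 0 → HasSum (fun n => tri (z ^ 5) n * x ^ n) (A x))
    (hB : ∀ x, x ≠ 0 → HasSum (fun n => tri ((z ^ 5) ^ 2) n * x ^ n) (B x)) :
    A (-z) * A (z ^ 2) + A z * A (-z ^ 2) = 2 * (B (z ^ 3) * B (z ^ 4)) := by
  have hz2 := pow_ne_zero 2 hz
  have hl := (hasSum_theta_mul (hA _ (neg_ne_zero.2 hz)) (hA _ hz2)).add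
    (hasSum_theta_mul (hA _ hz) (hA _ (neg_ne_zero.2 hz2)))
  have hr := (hasSum_theta_mul (hB _ (pow_ne_zero 3 hz)) (hB _ (pow_ne_zero 4 hz))).mul_left 2
  have hinj : Function.Injective fun p : ℤ × ℤ => (p.1 + p.2, p.1 - p.2) := by
    rintro ⟨a, b⟩ ⟨c, d⟩ h
    simp only [Prod.mk.injEq] at h
    ext <;> dsimp only <;> omega
  rw [← hinj.hasSum_iff] at hl
  · refine hl.unique (hr.congr_fun fun p => ?_)
    obtain ⟨i, j⟩ := p
    have hs : (-1 : ℂ) ^ (i - j) = (-1) ^ (i + j) := by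
      rw [show i + j = i - j + 2 * j by ring, zpow_add₀ (by norm_num), (even_two_mul j).neg_one_zpow,
        mul_one]
    have hij : (-1 : ℂ) ^ (i + j) = (-1) ^ i * (-1) ^ j := zpow_add₀ (by norm_num) i j
    have hexp : (5 * ((i + j) * (i + j - 1) / 2) + (i + j) + 5 * ((i - j) * (i - j - 1) / 2)
          + 2 * (i - j))
        = 10 * (i * (i - 1) / 2) + 3 * i + 10 * (j * (j - 1) / 2) + 4 * j := by
      have h1 := two_mul_tri_exponent (i + j)
      have h2 := two_mul_tri_exponent (i - j)
      have h3 := two_mul_tri_exponent i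
      have h4 := two_mul_tri_exponent j
      linarith
    have hpow := congrArg (fun e : ℤ => z ^ e) hexp
    simp only [zpow_add₀ hz _ (2 * (i - j)), zpow_add₀ hz _ (5 * _), zpow_add₀ hz _ (i + j),
      zpow_add₀ hz _ (4 * j), zpow_add₀ hz _ (10 * _), zpow_add₀ hz _ (3 * i)] at hpow
    have hz' : ∀ (k : ℕ) (e : ℤ), (z ^ k) ^ e = z ^ (k * e : ℤ) := fun k e => by
      rw [zpow_mul, zpow_natCast]
    dsimp only [Function.comp_apply]
    rw [← pow_mul, tri_pow, tri_pow, tri_pow, tri_pow, neg_eq_neg_one_mul z,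
      neg_eq_neg_one_mul (z ^ 2), mul_zpow (-1), mul_zpow (-1), hz', hz', hz', hs]
    push_cast
    linear_combination 2 * (-1) ^ (i + j) * hpow + 2 * (z ^ (10 * (i * (i - 1) / 2)) * z ^ (3 * i) *
      z ^ (10 * (j * (j - 1) / 2)) * z ^ (4 * j)) * hij + 2 * (-1) ^ (i + j) *
      (z ^ (5 * ((i + j) * (i + j - 1) / 2)) * z ^ (i + j) *
        z ^ (5 * ((i - j) * (i - j - 1) / 2)) * z ^ (2 * (i - j))) * neg_one_zpow_mul_self (i + j)
  · rintro ⟨n, m⟩ h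
    have hodd : Odd (n + m) := by
      rw [← Int.not_even_iff_odd]
      rintro ⟨i, hi⟩
      exact h ⟨(i, n - i), by ext <;> dsimp only <;> omega⟩
    have h1 := hodd.neg_one_zpow (α := ℂ)
    rw [zpow_add₀ (by norm_num)] at h1
    have h2 := neg_one_zpow_mul_self n
    dsimp only
    rw [neg_eq_neg_one_mul z, neg_eq_neg_one_mul (z ^ 2), mul_zpow (-1), mul_zpow (-1)]
    linear_combination (tri (z ^ 5) n * z ^ n * (tri (z ^ 5) m * (z ^ 2) ^ m)) *
      ((-1) ^ n * h1 - (-1) ^ m * h2)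

end ThetaPairs

section Lattice

variable {r : ℂ}

lemma one_sub_zpow_ne_zero (hr : ‖r‖ < 1) {e : ℤ} (he : e ≠ 0) : 1 - r ^ e ≠ 0 := by
  intro h
  have h1 : ‖r‖ ^ e = 1 := by rw [← norm_zpow, ← sub_eq_zero.1 h, norm_one]
  exact he ((zpow_eq_one_iff_right₀ (norm_nonneg r) hr.ne).1 h1)

lemma one_sub_pow_mul_zpow_ne_zero (hr0 : r ≠ 0) (hr : ‖r‖ < 1) {j k : ℕ}
    (hjk : ¬ (k : ℤ) ∣ j) (n : ℤ) : 1 - r ^ j * (r ^ k) ^ n ≠ 0 := by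
  rw [← zpow_natCast r j, ← zpow_natCast r k, ← zpow_mul, ← zpow_add₀ hr0]
  refine one_sub_zpow_ne_zero hr fun h => hjk ⟨-n, by linarith⟩

lemma norm_pow_lt_norm_pow (hr0 : r ≠ 0) (hr : ‖r‖ < 1) {j k : ℕ} (h : j < k) :
    ‖r ^ k‖ < ‖r ^ j‖ := by
  rw [norm_pow, norm_pow]
  exact pow_lt_pow_right_of_lt_one₀ (norm_pos_iff.2 hr0) hr h

lemma norm_pow_lt_one (hr : ‖r‖ < 1) {k : ℕ} (h : k ≠ 0) : ‖r ^ k‖ < 1 := by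
  rw [norm_pow]
  exact pow_lt_one₀ (norm_nonneg r) hr h

lemma tsum_tri_ne_zero {Q x : ℂ} (hQ0 : Q ≠ 0) (hQ : ‖Q‖ < 1) (hx : ‖Q‖ < ‖x‖) (hx1 : ‖x‖ < 1) :
    ∑' m : ℤ, tri Q m * x ^ m ≠ 0 := by
  have hx0 : 0 < ‖x‖ := (norm_nonneg Q).trans_lt hx
  obtain ⟨C, hC, h⟩ := exists_hasSum_tri hQ0 hQ
  rw [(h x (norm_pos_iff.1 hx0)).tsum_eq]
  refine mul_ne_zero hC (mul_ne_zero (qp_ne_zero hx1 hQ) (qp_ne_zero ?_ hQ))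
  rwa [norm_div, div_lt_one hx0]

lemma tsum_tri_self {Q : ℂ} (hQ0 : Q ≠ 0) (hQ : ‖Q‖ < 1) : ∑' m : ℤ, tri Q m * Q ^ m = 0 := by
  obtain ⟨C, -, h⟩ := exists_hasSum_tri hQ0 hQ
  rw [(h Q hQ0).tsum_eq, div_self hQ0, qp_one, mul_zero, mul_zero]

lemma tsum_lambert_eq_zero (hr0 : r ≠ 0) (hr : ‖r‖ < 1) :
    ∑' n : ℤ, (r ^ 15) ^ n / (1 - r ^ 35 * (r ^ 50) ^ n) = 0 := by
  have hQ0 := pow_ne_zero 50 hr0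
  have hQ : ‖r ^ 50‖ < 1 := norm_pow_lt_one hr (by norm_num)
  have ha : ‖r ^ 50‖ < ‖r ^ 15‖ := norm_pow_lt_norm_pow hr0 hr (by norm_num)
  have ha1 : ‖r ^ 15‖ < 1 := norm_pow_lt_one hr (by norm_num)
  have h := lambert_mul_theta hQ0 hQ ha ha1 (pow_ne_zero 35 hr0)
    (one_sub_pow_mul_zpow_ne_zero hr0 hr (by norm_num))
  rw [← pow_add, tsum_tri_self hQ0 hQ, mul_zero] at h
  exact (mul_eq_zero.1 h).resolve_right (tsum_tri_ne_zero hQ0 hQ ha ha1)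

lemma lambert_twist_eq_zero {ζ : ℂ} (hζ : IsPrimitiveRoot ζ 5) (hr0 : r ≠ 0) (hr : ‖r‖ < 1) :
    ∑ k ∈ Finset.range 5,
      ζ ^ k * ∑' n : ℤ, ((ζ ^ k * r) ^ 3) ^ n / (1 - r ^ 5 * (r ^ 10) ^ n) = 0 := by
  have hζ0 : ζ ≠ 0 := hζ.ne_zero (by norm_num)
  have hζn : ‖ζ‖ = 1 := hζ.norm'_eq_one (by norm_num)
  have h := hasSum_twist (ι := ℤ) hζ (r := r) (c := fun n => (1 - r ^ 5 * (r ^ 10) ^ n)⁻¹)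
    (e := fun n => 3 * n) (A := fun z => ∑' n : ℤ, (z ^ 3) ^ n / (1 - r ^ 5 * (r ^ 10) ^ n))
    fun k _ => by
      have hz : ‖(ζ ^ k * r) ^ 3‖ = ‖r ^ 3‖ := by simp [hζn]
      refine (summable_lambert (pow_ne_zero 10 hr0) (norm_pow_lt_one hr (by norm_num))
        (hz ▸ norm_pow_lt_norm_pow hr0 hr (by norm_num)) (hz ▸ norm_pow_lt_one hr (by norm_num))
        (pow_ne_zero 5 hr0)
        (one_sub_pow_mul_zpow_ne_zero hr0 hr (by norm_num))).hasSum.congr_fun fun n => ?_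
      rw [zpow_mul, div_eq_inv_mul]
      norm_cast
  refine h.unique ?_
  have hinj : Function.Injective fun t : ℤ => 5 * t + 3 := fun s t hst => by
    dsimp only at hst; omega
  rw [← hinj.hasSum_iff]
  · have hs := (summable_lambert (pow_ne_zero 50 hr0) (norm_pow_lt_one hr (by norm_num))
      (norm_pow_lt_norm_pow hr0 hr (by norm_num : 15 < 50)) (norm_pow_lt_one hr (by norm_num))
      (pow_ne_zero 35 hr0) (one_sub_pow_mul_zpow_ne_zero hr0 hr (by norm_num))).hasSum.mul_left
        (5 * r ^ 9)
    rw [tsum_lambert_eq_zero hr0 hr, mul_zero] at hs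
    refine hs.congr_fun fun t => ?_
    dsimp only [Function.comp_apply]
    rw [if_pos (by omega)]
    have h1 : r ^ (3 * (5 * t + 3)) = r ^ 9 * (r ^ 15) ^ t := by
      rw [← zpow_natCast r 9, ← zpow_natCast r 15, ← zpow_mul, ← zpow_add₀ hr0]
      congr 1; push_cast; ring
    have h2 : r ^ 5 * (r ^ 10) ^ (5 * t + 3) = r ^ 35 * (r ^ 50) ^ t := by
      rw [← zpow_natCast r 5, ← zpow_natCast r 10, ← zpow_natCast r 35, ← zpow_natCast r 50,
        ← zpow_mul, ← zpow_mul, ← zpow_add₀ hr0, ← zpow_add₀ hr0]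
      congr 1; push_cast; ring
    rw [h1, h2]
    ring
  · intro n hn
    refine if_neg fun hd => hn ⟨(n - 3) / 5, ?_⟩
    dsimp only
    omega

lemma lambertConst_ne_zero {s : ℝ} (hs0 : 0 < s) (hs1 : s < 1) :
    lambertConst ((s : ℂ) ^ 10) ((s : ℂ) ^ 5) ≠ 0 := by
  have hr0 : (s : ℂ) ≠ 0 := by exact_mod_cast hs0.ne'
  have hr : ‖(s : ℂ)‖ < 1 := by rwa [Complex.norm_real, Real.norm_of_nonneg hs0.le]
  have hQ0 := pow_ne_zero 10 hr0
  have hQ : ‖(s : ℂ) ^ 10‖ < 1 := norm_pow_lt_one hr (by norm_num)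
  have ha : ‖(s : ℂ) ^ 10‖ < ‖(s : ℂ) ^ 3‖ := norm_pow_lt_norm_pow hr0 hr (by norm_num)
  have ha1 : ‖(s : ℂ) ^ 3‖ < 1 := norm_pow_lt_one hr (by norm_num)
  have hden := one_sub_pow_mul_zpow_ne_zero hr0 hr (j := 5) (k := 10) (by norm_num)
  have h := lambert_mul_theta hQ0 hQ ha ha1 (pow_ne_zero 5 hr0) hden
  have hsum := summable_lambert hQ0 hQ ha ha1 (pow_ne_zero 5 hr0) hden
  set g : ℤ → ℝ := fun n => (s ^ 3) ^ n / (1 - s ^ 5 * (s ^ 10) ^ n) with hg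
  have hgc : ∀ n : ℤ, ((s : ℂ) ^ 3) ^ n / (1 - (s : ℂ) ^ 5 * ((s : ℂ) ^ 10) ^ n) = (g n : ℂ) :=
    fun n => by simp [hg]
  simp only [hgc] at h hsum
  rw [Complex.summable_ofReal] at hsum
  have hpair : ∀ n : ℕ, 0 < g n + g (-((n : ℤ) + 1)) := fun n => by
    have hlt : s ^ (10 * n + 5) < 1 := pow_lt_one₀ hs0.le hs1 (by omega)
    have hlt' : s ^ (7 * n + 2) < s ^ (3 * n) := pow_lt_pow_right_of_lt_one₀ hs0 hs1 (by omega)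
    have hd : 0 < 1 - s ^ (10 * n + 5) := sub_pos.2 hlt
    have hval : g n + g (-((n : ℤ) + 1))
        = (s ^ (3 * n) - s ^ (7 * n + 2)) / (1 - s ^ (10 * n + 5)) := by
      have h1 : g n = s ^ (3 * n) / (1 - s ^ (10 * n + 5)) := by
        simp only [hg, zpow_natCast, ← pow_mul, ← pow_add, add_comm]
      have h2 : g (-((n : ℤ) + 1)) = -s ^ (7 * n + 2) / (1 - s ^ (10 * n + 5)) := by
        have e1 : s ^ 5 * (s ^ 10) ^ (-((n : ℤ) + 1)) = (s ^ (10 * n + 5))⁻¹ := by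
          rw [zpow_neg, zpow_add_one₀ (pow_ne_zero 10 hs0.ne'), zpow_natCast]
          have := hs0.ne'
          field_simp
          ring
        have e2 : (s ^ 3) ^ (-((n : ℤ) + 1)) = s ^ (7 * n + 2) * (s ^ (10 * n + 5))⁻¹ := by
          rw [zpow_neg, zpow_add_one₀ (pow_ne_zero 3 hs0.ne'), zpow_natCast]
          have := hs0.ne'
          field_simp
          ring
        have hp : s ^ (10 * n + 5) ≠ 0 := pow_ne_zero _ hs0.ne'
        have hq : s ^ (10 * n + 5) - 1 ≠ 0 := by linarith
        simp only [hg]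
        rw [e1, e2]
        generalize s ^ (10 * n + 5) = P at *
        have := hd.ne'
        field_simp
        ring
      rw [h1, h2]
      ring
    rw [hval]
    exact div_pos (sub_pos.2 hlt') hd
  have hpos : 0 < ∑' n, g n := by
    have hn := hsum.hasSum.nat_add_neg_add_one
    rw [← hn.tsum_eq]
    exact hn.summable.tsum_pos (fun n => (hpair n).le) 0 (hpair 0)
  intro h0
  rw [h0, zero_mul, ← Complex.ofReal_tsum] at h
  exact mul_ne_zero (Complex.ofReal_ne_zero.2 hpos.ne') (tsum_tri_ne_zero hQ0 hQ ha ha1) h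

end Lattice

section Dissection

/-- The infinite product whose power series coefficients are studied. -/
noncomputable def thetaProduct (q : ℂ) : ℂ :=
  (qp (-q) (q ^ 5) * qp (-(q ^ 4)) (q ^ 5)) ^ 2 * (qp (q ^ 4) (q ^ 10) * qp (q ^ 6) (q ^ 10)) /
    ((qp (-(q ^ 2)) (q ^ 5) * qp (-(q ^ 3)) (q ^ 5)) ^ 2 * (qp (q ^ 3) (q ^ 10) * qp (q ^ 7) (q ^ 10)))

/-- The theta quotient complementary to `thetaProduct`. -/
noncomputable def thetaQuotient (q : ℂ) : ℂ :=
  (qp (q ^ 2) (q ^ 10) * qp (q ^ 8) (q ^ 10)) / (qp (q ^ 3) (q ^ 10) * qp (q ^ 7) (q ^ 10))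

variable {z : ℂ}

lemma thetaProduct_add_thetaQuotient (hz0 : z ≠ 0) (hz : ‖z‖ < 1) {C D : ℂ} (hC : C ≠ 0)
    (hA : ∀ x, x ≠ 0 → HasSum (fun n => tri (z ^ 5) n * x ^ n)
      (C * (qp x (z ^ 5) * qp (z ^ 5 / x) (z ^ 5))))
    (hB : ∀ x, x ≠ 0 → HasSum (fun n => tri (z ^ 10) n * x ^ n)
      (D * (qp x (z ^ 10) * qp (z ^ 10 / x) (z ^ 10)))) :
    thetaProduct z + thetaQuotient z = 2 * D ^ 2 / C ^ 4 *
      (C * (qp (-z) (z ^ 5) * qp (z ^ 5 / -z) (z ^ 5)) *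
        (C * (qp (z ^ 2) (z ^ 5) * qp (z ^ 5 / z ^ 2) (z ^ 5)))) := by
  have hpow : ∀ {k : ℕ}, k ≠ 0 → ‖z ^ k‖ < 1 := fun hk => norm_pow_lt_one hz hk
  have hpow' : ∀ {k : ℕ}, k ≠ 0 → ‖-z ^ k‖ < 1 := fun hk => by rw [norm_neg]; exact hpow hk
  have h5 : ‖z ^ 5‖ < 1 := hpow (by norm_num)
  have h10 : ‖z ^ 10‖ < 1 := hpow (by norm_num)
  have hpar := theta_parity hz0 hA (by simpa only [← pow_mul] using hB)
  have d1 : z ^ 5 / -z = -z ^ 4 := by field_simp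
  have d2 : z ^ 5 / z ^ 2 = z ^ 3 := by field_simp
  have d3 : z ^ 5 / z = z ^ 4 := by field_simp
  have d4 : z ^ 5 / -z ^ 2 = -z ^ 3 := by field_simp
  have d5 : z ^ 10 / z ^ 3 = z ^ 7 := by field_simp
  have d6 : z ^ 10 / z ^ 4 = z ^ 6 := by field_simp
  rw [d1, d2, d3, d4, d5, d6] at hpar
  have p1 := qp_mul_qp_neg h5 z
  have p2 := qp_mul_qp_neg h5 (z ^ 2)
  have p3 := qp_mul_qp_neg h5 (z ^ 3)
  have p4 := qp_mul_qp_neg h5 (z ^ 4)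
  simp only [← pow_mul, Nat.reduceMul] at p1 p2 p3 p4
  rw [d1, d2, thetaProduct, thetaQuotient, ← p1, ← p4, ← p2, ← p3]
  rw [← p2, ← p3] at hpar
  have n2 : qp (-z ^ 2) (z ^ 5) ≠ 0 := qp_ne_zero (hpow' (by norm_num)) h5
  have n3 : qp (-z ^ 3) (z ^ 5) ≠ 0 := qp_ne_zero (hpow' (by norm_num)) h5
  have m3 : qp (z ^ 3) (z ^ 10) ≠ 0 := qp_ne_zero (hpow (by norm_num)) h10
  have m7 : qp (z ^ 7) (z ^ 10) ≠ 0 := qp_ne_zero (hpow (by norm_num)) h10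
  generalize qp (-z ^ 2) (z ^ 5) = c2 at *
  generalize qp (-z ^ 3) (z ^ 5) = c3 at *
  generalize qp (z ^ 3) (z ^ 10) = d3 at *
  generalize qp (z ^ 7) (z ^ 10) = d7 at *
  generalize qp (z ^ 2) (z ^ 5) = e2 at *
  generalize qp (z ^ 3) (z ^ 5) = e3 at *
  generalize qp (-z ^ 4) (z ^ 5) = a4 at *
  generalize qp (-z) (z ^ 5) = a1 at *
  generalize qp (z ^ 4) (z ^ 5) = g4 at *
  generalize qp z (z ^ 5) = g1 at *
  field_simp
  linear_combination a1 * a4 * hpar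

lemma lambertConst_mul_thetaQuotient (hz0 : z ≠ 0) (hz : ‖z‖ < 1) :
    lambertConst (z ^ 10) (z ^ 5) * thetaQuotient z
      = ∑' n : ℤ, (z ^ 3) ^ n / (1 - z ^ 5 * (z ^ 10) ^ n) := by
  have hQ0 := pow_ne_zero 10 hz0
  have h10 : ‖z ^ 10‖ < 1 := norm_pow_lt_one hz (by norm_num)
  obtain ⟨C, hC, hth⟩ := exists_hasSum_tri hQ0 h10
  have h := lambert_mul_theta hQ0 h10 (norm_pow_lt_norm_pow hz0 hz (by norm_num : 3 < 10))
    (norm_pow_lt_one hz (by norm_num)) (pow_ne_zero 5 hz0)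
    (one_sub_pow_mul_zpow_ne_zero hz0 hz (by norm_num))
  rw [← pow_add, (hth _ (pow_ne_zero 3 hz0)).tsum_eq, (hth _ (pow_ne_zero _ hz0)).tsum_eq,
    show z ^ 10 / z ^ 3 = z ^ 7 by field_simp,
    show z ^ 10 / z ^ (3 + 5) = z ^ 2 by field_simp] at h
  have m3 : qp (z ^ 3) (z ^ 10) ≠ 0 := qp_ne_zero (norm_pow_lt_one hz (by norm_num)) h10
  have m7 : qp (z ^ 7) (z ^ 10) ≠ 0 := qp_ne_zero (norm_pow_lt_one hz (by norm_num)) h10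
  rw [thetaQuotient, mul_div_assoc', div_eq_iff (mul_ne_zero m3 m7)]
  refine mul_left_cancel₀ hC ?_
  linear_combination -h

lemma thetaProduct_twist_eq_zero {ζ : ℂ} (hζ : IsPrimitiveRoot ζ 5) {s : ℝ} (hs0 : 0 < s)
    (hs1 : s < 1) :
    ∑ k ∈ Finset.range 5, ζ ^ k * thetaProduct (ζ ^ k * s) = 0 := by
  have hζ0 : ζ ≠ 0 := hζ.ne_zero (by norm_num)
  have hζn : ‖ζ‖ = 1 := hζ.norm'_eq_one (by norm_num)
  have hr0 : (s : ℂ) ≠ 0 := by exact_mod_cast hs0.ne'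
  have hr : ‖(s : ℂ)‖ < 1 := by rwa [Complex.norm_real, Real.norm_of_nonneg hs0.le]
  have hz0 : ∀ k, ζ ^ k * (s : ℂ) ≠ 0 := fun k => mul_ne_zero (pow_ne_zero k hζ0) hr0
  have hz : ∀ k, ‖ζ ^ k * (s : ℂ)‖ < 1 := fun k => by
    rwa [norm_mul, norm_pow, hζn, one_pow, one_mul]
  have hz5 : ∀ k, (ζ ^ k * (s : ℂ)) ^ 5 = s ^ 5 := fun k => by
    rw [mul_pow, ← pow_mul, mul_comm k, pow_mul, hζ.pow_eq_one, one_pow, one_mul]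
  have hz10 : ∀ k, (ζ ^ k * (s : ℂ)) ^ 10 = s ^ 10 := fun k => by
    rw [show 10 = 5 * 2 from rfl, pow_mul, hz5, pow_mul]
  obtain ⟨C, hC, hA⟩ := exists_hasSum_tri (pow_ne_zero 5 hr0) (norm_pow_lt_one hr (by norm_num))
  obtain ⟨D, -, hB⟩ := exists_hasSum_tri (pow_ne_zero 10 hr0) (norm_pow_lt_one hr (by norm_num))
  have hadd : ∀ k, _ := fun k =>
    thetaProduct_add_thetaQuotient (hz0 k) (hz k) hC (by simpa only [hz5] using hA)
      (by simpa only [hz10] using hB)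
  have hL : ∀ k, _ := fun k => lambertConst_mul_thetaQuotient (hz0 k) (hz k)
  simp only [hz5] at hadd
  simp only [hz5, hz10] at hL
  have h1 := theta_pair_twist_eq_zero hζ hr0 hA
  have h2 := lambert_twist_eq_zero hζ hr0 hr
  simp only [← hL, mul_left_comm (_ ^ _) (lambertConst _ _), ← Finset.mul_sum] at h2
  replace h2 := (mul_eq_zero.1 h2).resolve_left (lambertConst_ne_zero hs0 hs1)
  simp only [fun k => eq_sub_of_add_eq (hadd k), mul_sub, Finset.sum_sub_distrib, h2, sub_zero,
    mul_left_comm (_ ^ _) (2 * D ^ 2 / C ^ 4), ← Finset.mul_sum]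
  rw [h1, mul_zero]

end Dissection

section PowerSeries

/-- A power series vanishing on a real interval at the origin has no nonzero coefficient. -/
lemma coeff_eq_zero_of_hasSum_zero {c : ℕ → ℂ}
    (h : ∀ s : ℝ, 0 < s → s < 1 → HasSum (fun n => c n * (s : ℂ) ^ n) 0) (n : ℕ) : c n = 0 := by
  have hsum : ∀ q : ℂ, ‖q‖ < 1 → Summable fun n => c n * q ^ n := fun q hq => by
    obtain ⟨s, hs, hs1⟩ := exists_between hq
    have hs0 := (norm_nonneg q).trans_lt hs
    refine Summable.of_norm_bounded (h s hs0 hs1).summable.norm fun n => ?_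
    rw [norm_mul, norm_mul, norm_pow, norm_pow, Complex.norm_real, Real.norm_of_nonneg hs0.le]
    gcongr
  set Φ : ℂ → ℂ := fun q => ∑' n, c n * q ^ n
  have hΦ : HasFPowerSeriesAt Φ (FormalMultilinearSeries.ofScalars ℂ c) 0 := by
    rw [hasFPowerSeriesAt_iff]
    filter_upwards [Metric.ball_mem_nhds (0 : ℂ) one_pos] with q hq
    rw [zero_add]
    simpa [mul_comm] using (hsum q (by simpa using hq)).hasSum
  have hfreq : ∃ᶠ q in 𝓝[≠] (0 : ℂ), Φ q = 0 := by
    have ht : Tendsto (fun s : ℝ => (s : ℂ)) (𝓝[>] 0) (𝓝[≠] 0) := by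
      refine tendsto_nhdsWithin_iff.2 ⟨?_, ?_⟩
      · exact (Complex.continuous_ofReal.tendsto' 0 0 Complex.ofReal_zero).mono_left
          nhdsWithin_le_nhds
      · filter_upwards [self_mem_nhdsWithin] with s hs
        exact Complex.ofReal_ne_zero.2 (ne_of_gt hs)
    refine ht.frequently (Eventually.frequently ?_)
    filter_upwards [Ioo_mem_nhdsGT (zero_lt_one' ℝ)] with s hs
    exact (h s hs.1 hs.2).tsum_eq
  have h0 := hΦ.analyticAt.frequently_zero_iff_eventually_zero.1 hfreq
  have hp := (hΦ.congr h0).eq_zero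
  rw [← FormalMultilinearSeries.coeff_ofScalars (𝕜 := ℂ) (p := c), hp]
  rfl

end PowerSeries

end ThetaSeries

theorem stmt_18 : ∀ γ : ℕ → ℂ,
    (∀ q : ℂ, ‖q‖ < 1 →
      HasSum (fun n : ℕ => γ n * q ^ n)
        ((qp (-q) (q ^ 5) * qp (-(q ^ 4)) (q ^ 5)) ^ 2 * (qp (q ^ 4) (q ^ 10) * qp (q ^ 6) (q ^ 10)) /
          ((qp (-(q ^ 2)) (q ^ 5) * qp (-(q ^ 3)) (q ^ 5)) ^ 2 * (qp (q ^ 3) (q ^ 10) * qp (q ^ 7) (q ^ 10))))) →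
    ∀ n : ℕ, γ (5 * n + 4) = 0 := by
  intro γ hγ n
  have hζ := Complex.isPrimitiveRoot_exp 5 (by norm_num)
  set ζ := Complex.exp (2 * Real.pi * Complex.I / (5 : ℕ))
  have key : ∀ s : ℝ, 0 < s → s < 1 →
      HasSum (fun n : ℕ => (if 5 ∣ (n : ℤ) + 1 then 5 * γ n else 0) * (s : ℂ) ^ n) 0 := by
    intro s hs0 hs1
    have h := ThetaSeries.hasSum_twist hζ (r := s) (c := γ) (e := fun n => (n : ℤ))
      (A := ThetaSeries.thetaProduct) fun k _ => ?_
    · rw [ThetaSeries.thetaProduct_twist_eq_zero hζ hs0 hs1] at h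
      refine h.congr_fun fun n => ?_
      split_ifs
      · rw [zpow_natCast, mul_assoc]
      · rw [zero_mul]
    · simp only [zpow_natCast]
      refine hγ _ ?_
      rwa [norm_mul, norm_pow, hζ.norm'_eq_one (by norm_num), one_pow, one_mul, Complex.norm_real,
        Real.norm_of_nonneg hs0.le]
  have h := ThetaSeries.coeff_eq_zero_of_hasSum_zero key (5 * n + 4)
  rw [if_pos (by omega)] at h
  exact (mul_eq_zero.1 h).resolve_left (by norm_num)
end
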